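/- Let m ≥ 5 be a prime, let k be a positive integer, let r be an odd positive integer with r < m^k, and let ℓ be a prime different from 2, 3 and m. Then there exists a positive integer K such that for all positive integers μ and all positive integers n coprime to ℓ for which 24 divides m^k·ℓ^{2μK−1}·n + r, one has p_r((m^k·ℓ^{2μK−1}·n + r)/24) ≡ 0 (mod m^k). -/

import Mathlib

/-- `multipartition r n` is the number of `r`-component multipartitions of `n`,
i.e. the number of `r`-tuples of integer partitions whose sizes sum to `n`. -/
def multipartition (r n : ℕ) : ℕ :=
  ∑ c ∈ Finset.Nat.antidiagonalTuple r n, ∏ i, Fintype.card (Nat.Partition (c i))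

namespace MPC
open PowerSeries

/-- Euler product -/
noncomputable def Eu : ℤ⟦X⟧ := pentagonalSeries ℤ
/-- partition generating function -/
noncomputable def Pg : ℤ⟦X⟧ := PowerSeries.mk fun n => (Fintype.card (Nat.Partition n) : ℤ)

open PowerSeries.WithPiTopology in
lemma Eu_mul_Pg : Eu * Pg = 1 := by
  have h1 := hasProd_one_sub_X_pow ℤ
  have h2 := Nat.Partition.hasProd_powerSeriesMk_card_restricted ℤ (fun _ => True)
  have h3 := h1.mul h2
  have h4 : (PowerSeries.mk fun n => ((Nat.Partition.restricted n (fun _ => True)).card : ℤ)) = Pg := by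
    ext n
    simp only [Pg, Nat.Partition.restricted, coeff_mk, implies_true, Finset.filter_true, Finset.card_univ]
  rw [h4] at h3
  have h5 : (fun i : ℕ => (1 - X ^ (i + 1) : ℤ⟦X⟧) * (if True then ∑' j : ℕ, X ^ ((i + 1) * j) else 1))
      = fun _ => 1 := by
    ext1 i
    rw [if_pos trivial]
    simp_rw [pow_mul]
    rw [mul_comm]
    refine Summable.tsum_pow_mul_one_sub ?_
    exact summable_pow_of_constantCoeff_eq_zero (by simp)
  rw [h5] at h3
  exact h3.unique hasProd_one

open PowerSeries.WithPiTopology in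
lemma Eu_trunc (N n : ℕ) (h : n ≤ N) : coeff n Eu = coeff n (∏ i ∈ Finset.range N, (1 - X ^ (i + 1) : ℤ⟦X⟧)) := by
  have h1 := (hasProd_one_sub_X_pow ℤ).tendsto_prod_nat
  rw [tendsto_iff_coeff_tendsto] at h1
  have h2 := h1 n
  have h3 : ∀ K, N ≤ K → coeff n (∏ i ∈ Finset.range K, (1 - X ^ (i + 1) : ℤ⟦X⟧)) =
      coeff n (∏ i ∈ Finset.range N, (1 - X ^ (i + 1) : ℤ⟦X⟧)) := by
    intro K hK
    induction K, hK using Nat.le_induction with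
    | base => rfl
    | succ K hK ih =>
      rw [Finset.prod_range_succ, mul_sub, mul_one, map_sub, ih, coeff_mul_X_pow', if_neg (by omega), sub_zero]
  have h4 := h2.congr' (Filter.eventually_atTop.2 ⟨N, h3⟩)
  exact (tendsto_nhds_unique h4 tendsto_const_nhds)

lemma multipartition_eq (r n : ℕ) : (multipartition r n : ℤ) = coeff n (Pg ^ r) := by
  have h : (Pg ^ r) = ∏ i : Fin r, Pg := by simp
  rw [h, coeff_prod, multipartition, Nat.cast_sum]
  symm
  refine Finset.sum_bij' (fun f _ => ⇑f) (fun g _ => Finsupp.equivFunOnFinite.symm g) ?_ ?_ ?_ ?_ ?_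
  · intro f hf
    rw [Finset.mem_finsuppAntidiag] at hf
    rw [Finset.Nat.mem_antidiagonalTuple]
    exact hf.1
  · intro f hf
    rw [Finset.mem_finsuppAntidiag]
    rw [Finset.Nat.mem_antidiagonalTuple] at hf
    exact ⟨by simpa using hf, by simp⟩
  · intro f hf
    ext i; simp
  · intro f hf
    ext i; simp
  · intro f hf
    simp [Pg]
end MPC


namespace MPC
open PowerSeries Complex

/-- absolute convergence on the open unit disc -/
def Conv (P : ℤ⟦X⟧) : Prop :=
  ∀ x : ℝ, 0 < x → x < 1 → Summable fun n => |((coeff n P : ℤ) : ℝ)| * x ^ n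

/-- the exponential -/
noncomputable def qe (z : ℂ) : ℂ := cexp (2 * Real.pi * I * z)

/-- evaluation at q = e(z) -/
noncomputable def ev (P : ℤ⟦X⟧) (z : ℂ) : ℂ := ∑' n, ((coeff n P : ℤ) : ℂ) * qe z ^ n

lemma qe_add (z w : ℂ) : qe (z + w) = qe z * qe w := by
  simp only [qe, mul_add, Complex.exp_add]

lemma qe_ne_zero (z : ℂ) : qe z ≠ 0 := Complex.exp_ne_zero _

lemma qe_zero : qe 0 = 1 := by simp [qe]

lemma qe_neg (z : ℂ) : qe (-z) = (qe z)⁻¹ := by simp [qe, Complex.exp_neg]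

lemma qe_sub (z w : ℂ) : qe (z - w) = qe z * (qe w)⁻¹ := by
  rw [sub_eq_add_neg, qe_add, qe_neg]

lemma qe_nat_mul (n : ℕ) (z : ℂ) : qe (n * z) = qe z ^ n := by
  rw [qe, qe, ← Complex.exp_nat_mul]; congr 1; ring

lemma qe_int (n : ℤ) : qe n = 1 := by
  rw [qe, mul_comm]; exact Complex.exp_int_mul_two_pi_mul_I n

lemma qe_nat (n : ℕ) : qe n = 1 := by exact_mod_cast qe_int n

lemma qe_add_int (z : ℂ) (n : ℤ) : qe (z + n) = qe z := by rw [qe_add, qe_int, mul_one]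

lemma qe_eq_of_sub (z w : ℂ) (n : ℤ) (h : z - w = n) : qe z = qe w := by
  rw [show z = w + n by rw [← h]; ring, qe_add_int]

lemma norm_qe (z : ℂ) : ‖qe z‖ = Real.exp (-2 * Real.pi * z.im) := by
  rw [qe, Complex.norm_exp]; congr 1; simp

lemma norm_qe_lt {z : ℂ} (hz : 0 < z.im) : ‖qe z‖ < 1 := by
  rw [norm_qe, Real.exp_lt_one_iff]; nlinarith [Real.pi_pos]

lemma norm_qe_pos (z : ℂ) : 0 < ‖qe z‖ := norm_pos_iff.2 (qe_ne_zero z)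

lemma Conv.summable_norm {P : ℤ⟦X⟧} (h : Conv P) {z : ℂ} (hz : 0 < z.im) :
    Summable fun n => ‖((coeff n P : ℤ) : ℂ) * qe z ^ n‖ := by
  refine (h _ (norm_qe_pos z) (norm_qe_lt hz)).congr fun n => ?_
  rw [norm_mul, norm_pow, Complex.norm_intCast]

lemma Conv.summable {P : ℤ⟦X⟧} (h : Conv P) {z : ℂ} (hz : 0 < z.im) :
    Summable fun n => ((coeff n P : ℤ) : ℂ) * qe z ^ n := (h.summable_norm hz).of_norm

lemma Conv.hasSum {P : ℤ⟦X⟧} (h : Conv P) {z : ℂ} (hz : 0 < z.im) :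
    HasSum (fun n => ((coeff n P : ℤ) : ℂ) * qe z ^ n) (ev P z) := (h.summable hz).hasSum

lemma Conv.add {P Q : ℤ⟦X⟧} (hP : Conv P) (hQ : Conv Q) : Conv (P + Q) := by
  intro x hx hx1
  refine ((hP x hx hx1).add (hQ x hx hx1)).of_nonneg_of_le (fun n => by positivity) fun n => ?_
  rw [← add_mul]
  gcongr
  rw [map_add, Int.cast_add]; exact abs_add_le _ _

lemma Conv.const_mul {P : ℤ⟦X⟧} (c : ℤ) (hP : Conv P) : Conv (C c * P) := by
  intro x hx hx1
  refine ((hP x hx hx1).mul_left |(c:ℝ)|).congr fun n => ?_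
  rw [coeff_C_mul, Int.cast_mul, abs_mul]; ring

lemma Conv.mul {P Q : ℤ⟦X⟧} (hP : Conv P) (hQ : Conv Q) : Conv (P * Q) := by
  intro x hx hx1
  have h1 := hP x hx hx1
  have h2 := hQ x hx hx1
  have h3 : Summable fun i : ℕ × ℕ => (|((coeff i.1 P : ℤ) : ℝ)| * x ^ i.1) * (|((coeff i.2 Q : ℤ) : ℝ)| * x ^ i.2) :=
    Summable.mul_of_nonneg h1 h2 (fun n => mul_nonneg (abs_nonneg _) (pow_nonneg hx.le _))
      (fun n => mul_nonneg (abs_nonneg _) (pow_nonneg hx.le _))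
  have h := summable_sum_mul_antidiagonal_of_summable_mul
    (f := fun n => |((coeff n P : ℤ) : ℝ)| * x ^ n) (g := fun n => |((coeff n Q : ℤ) : ℝ)| * x ^ n) h3
  refine h.of_nonneg_of_le (fun n => mul_nonneg (abs_nonneg _) (pow_nonneg hx.le _)) fun n => ?_
  rw [coeff_mul, Int.cast_sum]
  refine (mul_le_mul_of_nonneg_right (Finset.abs_sum_le_sum_abs _ _) (pow_nonneg hx.le n)).trans ?_
  rw [Finset.sum_mul]
  refine (Finset.sum_congr rfl fun p hp => ?_).le
  rw [Finset.HasAntidiagonal.mem_antidiagonal] at hp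
  rw [← hp, pow_add, Int.cast_mul, abs_mul]; ring

lemma Conv.one : Conv 1 := by
  intro x hx hx1
  refine summable_of_hasFiniteSupport ((Set.finite_singleton 0).subset fun n hn => ?_)
  by_contra h
  simp only [Set.mem_singleton_iff] at h
  simp [coeff_one, h] at hn

lemma Conv.X : Conv X := by
  intro x hx hx1
  refine summable_of_hasFiniteSupport ((Set.finite_singleton 1).subset fun n hn => ?_)
  by_contra h
  simp only [Set.mem_singleton_iff] at h
  simp [coeff_X, h] at hn

lemma Conv.pow {P : ℤ⟦X⟧} (hP : Conv P) (n : ℕ) : Conv (P ^ n) := by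
  induction n with
  | zero => rw [pow_zero]; exact Conv.one
  | succ n ih => rw [pow_succ]; exact ih.mul hP

lemma ev_add {P Q : ℤ⟦X⟧} (hP : Conv P) (hQ : Conv Q) {z : ℂ} (hz : 0 < z.im) :
    ev (P + Q) z = ev P z + ev Q z := by
  rw [ev, ev, ev, ← (hP.summable hz).tsum_add (hQ.summable hz)]
  congr 1; ext n; rw [map_add]; push_cast; ring

lemma ev_C_mul (c : ℤ) (P : ℤ⟦X⟧) (z : ℂ) : ev (C c * P) z = c * ev P z := by
  rw [ev, ev, ← tsum_mul_left]
  congr 1; ext n; rw [coeff_C_mul]; push_cast; ring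

lemma ev_mul {P Q : ℤ⟦X⟧} (hP : Conv P) (hQ : Conv Q) {z : ℂ} (hz : 0 < z.im) :
    ev (P * Q) z = ev P z * ev Q z := by
  rw [ev, ev, ev, tsum_mul_tsum_eq_tsum_sum_antidiagonal_of_summable_norm (hP.summable_norm hz) (hQ.summable_norm hz)]
  congr 1; ext n
  rw [coeff_mul, Int.cast_sum, Finset.sum_mul]
  refine Finset.sum_congr rfl fun p hp => ?_
  rw [Finset.HasAntidiagonal.mem_antidiagonal] at hp
  rw [← hp, pow_add]; push_cast; ring

lemma ev_one (z : ℂ) : ev 1 z = 1 := by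
  rw [ev, tsum_eq_single 0 (fun n hn => by simp [coeff_one, hn])]; simp

lemma ev_X (z : ℂ) : ev X z = qe z := by
  rw [ev, tsum_eq_single 1 (fun n hn => by simp [coeff_X, hn])]; simp

lemma ev_pow {P : ℤ⟦X⟧} (hP : Conv P) (n : ℕ) {z : ℂ} (hz : 0 < z.im) : ev (P ^ n) z = ev P z ^ n := by
  induction n with
  | zero => simp [ev_one]
  | succ n ih => rw [pow_succ, ev_mul (hP.pow n) hP hz, ih, pow_succ]

lemma ev_add_int (P : ℤ⟦X⟧) (z : ℂ) (n : ℤ) : ev P (z + n) = ev P z := by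
  simp only [ev, qe_add_int]

lemma Conv.of_poly {P : ℤ⟦X⟧} (k : ℕ) (B : ℝ) (h : ∀ n, |((coeff n P : ℤ) : ℝ)| ≤ B * n ^ k) : Conv P := by
  intro x hx hx1
  have h1 := (summable_pow_mul_geometric_of_norm_lt_one k (r := x) (by rwa [Real.norm_of_nonneg hx.le])).mul_left B
  refine h1.of_nonneg_of_le (fun n => by positivity) fun n => ?_
  rw [← mul_assoc]; gcongr; exact h n

lemma coeff_Eu_abs (n : ℕ) : |((coeff n Eu : ℤ) : ℝ)| ≤ 1 := by
  by_cases h : ∃ k : ℤ, pentagonal k = n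
  · obtain ⟨k, rfl⟩ := h
    rw [Eu, coeff_pentagonalSeries_pentagonal]
    rcases Int.units_eq_one_or (Int.negOnePow k) with h | h <;> simp [h]
  · have : coeff n Eu = 0 := by
      rw [Eu]
      exact coeff_pentagonalSeries_eq_zero ℤ (by simpa using h)
    simp [this]

lemma Conv_Eu : Conv Eu := .of_poly 0 1 fun n => by simpa using coeff_Eu_abs n

end MPC


namespace MPC
open PowerSeries Complex

/-- geometric series in `X^(i+1)` -/
noncomputable def Ge (i : ℕ) : ℤ⟦X⟧ := PowerSeries.mk fun n => if (i + 1) ∣ n then 1 else 0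

lemma Ge_spec (i : ℕ) : (1 - X ^ (i + 1)) * Ge i = 1 := by
  ext n
  rw [sub_mul, one_mul, map_sub, coeff_X_pow_mul', coeff_one]
  simp only [Ge, coeff_mk]
  by_cases h : i + 1 ≤ n
  · rw [if_pos h, if_neg (by omega : n ≠ 0)]
    have h3 : (i + 1 ∣ n - (i + 1)) ↔ (i + 1 ∣ n) := by
      obtain ⟨c, rfl⟩ := Nat.exists_eq_add_of_le h
      simp
    simp only [h3, sub_self]
  · rw [if_neg h, sub_zero]
    by_cases h2 : n = 0
    · simp [h2]
    · rw [if_neg h2, if_neg]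
      intro h3; exact h (Nat.le_of_dvd (by omega) h3)

lemma Ge_Conv (i : ℕ) : Conv (Ge i) := .of_poly 0 1 fun n => by
  simp only [Ge, coeff_mk]; split_ifs <;> simp

/-- truncated partition generating function -/
noncomputable def RN (N : ℕ) : ℤ⟦X⟧ := ∏ i ∈ Finset.range N, Ge i

lemma RN_Conv (N : ℕ) : Conv (RN N) := by
  induction N with
  | zero => exact Conv.one
  | succ N ih => rw [RN, Finset.prod_range_succ]; exact ih.mul (Ge_Conv N)

lemma RN_nonneg (N n : ℕ) : 0 ≤ coeff n (RN N) := by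
  induction N generalizing n with
  | zero => simp only [RN, Finset.range_zero, Finset.prod_empty, coeff_one]; split_ifs <;> simp
  | succ N ih =>
    rw [RN, Finset.prod_range_succ, coeff_mul]
    refine Finset.sum_nonneg fun p _ => mul_nonneg (ih _) ?_
    simp only [Ge, coeff_mk]; split_ifs <;> simp

lemma RN_eq (N n : ℕ) (h : n ≤ N) : coeff n Pg = coeff n (RN N) := by
  have h0 : (∏ i ∈ Finset.range N, (1 - X ^ (i + 1) : ℤ⟦X⟧)) * RN N = 1 := by
    rw [RN, ← Finset.prod_mul_distrib]; exact Finset.prod_eq_one fun i _ => Ge_spec i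
  have h1 : Eu - (∏ i ∈ Finset.range N, (1 - X ^ (i + 1) : ℤ⟦X⟧)) ∈ Ideal.span {(X:ℤ⟦X⟧) ^ (N+1)} := by
    rw [Ideal.mem_span_singleton, X_pow_dvd_iff]
    intro k hk
    rw [map_sub, Eu_trunc N k (by omega), sub_self]
  have h2 : RN N - Pg = (Eu - (∏ i ∈ Finset.range N, (1 - X ^ (i + 1) : ℤ⟦X⟧))) * (RN N * Pg) := by
    linear_combination (-RN N) * Eu_mul_Pg + Pg * h0
  have h3 : RN N - Pg ∈ Ideal.span {(X:ℤ⟦X⟧) ^ (N+1)} := by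
    rw [h2]; exact Ideal.mul_mem_right _ _ h1
  rw [Ideal.mem_span_singleton, X_pow_dvd_iff] at h3
  have := h3 n (by omega)
  rw [map_sub, sub_eq_zero] at this
  exact this.symm

lemma exists_qe_eq (x : ℝ) (hx : 0 < x) (hx1 : x < 1) : ∃ z : ℂ, 0 < z.im ∧ qe z = x := by
  refine ⟨((-Real.log x / (2 * Real.pi) : ℝ) : ℂ) * I, ?_, ?_⟩
  · have h1 := Real.log_neg hx hx1
    have h2 : 0 < -Real.log x / (2 * Real.pi) := div_pos (by linarith) (by positivity)
    rw [Complex.im_ofReal_mul]; simpa using h2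
  · rw [qe]
    have : (2 * Real.pi * I * (((-Real.log x / (2 * Real.pi) : ℝ) : ℂ) * I)) = (Real.log x : ℂ) := by
      push_cast
      have : (Real.pi : ℂ) ≠ 0 := by exact_mod_cast Real.pi_ne_zero
      field_simp
      linear_combination (-(Real.log x : ℂ)) * I_sq
    rw [this, ← Complex.ofReal_exp, Real.exp_log hx]

lemma ev_one_sub (i : ℕ) {z : ℂ} (hz : 0 < z.im) : (1 - qe z ^ (i + 1)) * ev (Ge i) z = 1 := by
  have h := congrArg (fun P => ev P z) (Ge_spec i)
  have h2 : (1 - X ^ (i + 1) : ℤ⟦X⟧) = 1 + C (-1) * X ^ (i+1) := by simp; ring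
  rw [h2, ev_mul (Conv.one.add ((Conv.X.pow _).const_mul _)) (Ge_Conv i) hz,
    ev_add Conv.one ((Conv.X.pow _).const_mul _) hz, ev_C_mul, ev_pow Conv.X _ hz, ev_one, ev_X] at h
  push_cast at h; linear_combination h

lemma RN_bound (x : ℝ) (hx : 0 < x) (hx1 : x < 1) (N : ℕ) {z : ℂ} (hz : 0 < z.im) (hq : qe z = x) :
    ‖ev (RN N) z‖ ≤ Real.exp (∑ i ∈ Finset.range N, x ^ i * (x / (1 - x))) := by
  induction N with
  | zero => simp [RN, ev_one]
  | succ N ih =>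
    have h1 : ‖ev (Ge N) z‖ ≤ Real.exp (x ^ N * (x / (1 - x))) := by
      have h := congrArg norm (ev_one_sub N hz)
      rw [norm_mul, norm_one, hq] at h
      have hu : x ^ (N+1) ≤ x := pow_le_of_le_one hx.le hx1.le (by omega)
      have hu0 : 0 < x ^ (N+1) := by positivity
      have h3 : ‖(1 - (x:ℂ) ^ (N+1))‖ = 1 - x ^ (N+1) := by
        rw [← Complex.ofReal_pow, ← Complex.ofReal_one, ← Complex.ofReal_sub, Complex.norm_real,
          Real.norm_of_nonneg (by linarith)]
      rw [h3] at h
      have h4 : ‖ev (Ge N) z‖ = x ^ (N+1) / (1 - x ^ (N+1)) + 1 := by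
        have : 1 - x ^ (N+1) ≠ 0 := by linarith
        field_simp
        linarith
      rw [h4]
      refine (Real.add_one_le_exp _).trans (Real.exp_le_exp.2 ?_)
      rw [← mul_div_assoc, ← pow_succ]
      gcongr
    have h0 : RN (N+1) = RN N * Ge N := Finset.prod_range_succ _ _
    rw [h0, ev_mul (RN_Conv N) (Ge_Conv N) hz, norm_mul,
      Finset.sum_range_succ, Real.exp_add]
    gcongr

lemma Conv_Pg : Conv Pg := by
  intro x hx hx1
  obtain ⟨z, hz, hq⟩ := exists_qe_eq x hx hx1
  refine summable_of_sum_range_le (c := Real.exp ((1 - x)⁻¹ * (x / (1 - x)))) (fun n => by positivity) fun N => ?_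
  have h1 : ∀ N n, 0 ≤ ((coeff n (RN N) : ℤ) : ℝ) := fun N n => by exact_mod_cast RN_nonneg N n
  have hs : Summable fun n => ((coeff n (RN N) : ℤ) : ℝ) * x ^ n :=
    (RN_Conv N x hx hx1).congr fun n => by rw [abs_of_nonneg (h1 N n)]
  calc ∑ n ∈ Finset.range N, |((coeff n Pg : ℤ) : ℝ)| * x ^ n
      = ∑ n ∈ Finset.range N, ((coeff n (RN N) : ℤ) : ℝ) * x ^ n := by
        refine Finset.sum_congr rfl fun n hn => ?_
        rw [RN_eq N n (by simpa using (Finset.mem_range.1 hn).le), abs_of_nonneg (h1 N n)]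
    _ ≤ ∑' n, ((coeff n (RN N) : ℤ) : ℝ) * x ^ n :=
        hs.sum_le_tsum _ fun n _ => mul_nonneg (h1 N n) (by positivity)
    _ ≤ ‖ev (RN N) z‖ := by
        have : ev (RN N) z = ((∑' n, ((coeff n (RN N) : ℤ) : ℝ) * x ^ n : ℝ) : ℂ) := by
          rw [ev, hq, Complex.ofReal_tsum]; push_cast; rfl
        rw [this, Complex.norm_real]
        exact Real.le_norm_self _
    _ ≤ _ := RN_bound x hx hx1 N hz hq
    _ ≤ _ := by
        rw [← Finset.sum_mul, ← tsum_geometric_of_lt_one hx.le hx1]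
        have : 0 ≤ x / (1 - x) := div_nonneg hx.le (by linarith)
        gcongr
        · exact (summable_geometric_of_lt_one hx.le hx1).sum_le_tsum _ fun n _ => by positivity

lemma ev_Eu_mul_Pg {z : ℂ} (hz : 0 < z.im) : ev Eu z * ev Pg z = 1 := by
  rw [← ev_mul Conv_Eu Conv_Pg hz, Eu_mul_Pg, ev_one]

lemma ev_Eu_ne_zero {z : ℂ} (hz : 0 < z.im) : ev Eu z ≠ 0 := left_ne_zero_of_mul (by rw [ev_Eu_mul_Pg hz]; exact one_ne_zero)

/-- subsequence along an arithmetic progression -/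
noncomputable def sub (L d : ℕ) (P : ℤ⟦X⟧) : ℤ⟦X⟧ := PowerSeries.mk fun n => coeff (L * n + d) P

lemma Conv.sub {P : ℤ⟦X⟧} (hP : Conv P) (L d : ℕ) (hL : 0 < L) : Conv (MPC.sub L d P) := by
  intro x hx hx1
  have hy0 : 0 < x ^ ((L : ℝ)⁻¹) := by positivity
  have hy1 : x ^ ((L : ℝ)⁻¹) < 1 := Real.rpow_lt_one hx.le hx1 (by positivity)
  have hyL : (x ^ ((L : ℝ)⁻¹)) ^ L = x := Real.rpow_inv_natCast_pow hx.le hL.ne'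
  set y := x ^ ((L : ℝ)⁻¹)
  have h := (hP y hy0 hy1).comp_injective (i := fun n => L * n + d) (fun a b h => by
    simpa [hL.ne'] using h)
  refine (h.mul_right (y ^ d)⁻¹).congr fun n => ?_
  simp only [MPC.sub, coeff_mk, Function.comp, pow_add, pow_mul, hyL]
  field_simp

lemma Conv.expand {P : ℤ⟦X⟧} (hP : Conv P) (L : ℕ) (hL : L ≠ 0) : Conv (PowerSeries.expand L hL P) := by
  intro x hx hx1
  have h := hP (x ^ L) (by positivity) (pow_lt_one₀ hx.le hx1 hL)
  have hi : Function.Injective (fun n : ℕ => L * n) := fun a b h => by simpa [hL] using h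
  rw [← hi.summable_iff]
  · refine h.congr fun n => ?_
    simp [PowerSeries.coeff_expand, hL, pow_mul, Nat.mul_div_cancel_left _ (Nat.pos_of_ne_zero hL)]
  · intro n hn
    rw [PowerSeries.coeff_expand, if_neg]
    · simp
    · rintro ⟨k, rfl⟩; exact hn ⟨k, rfl⟩

lemma ev_expand (P : ℤ⟦X⟧) (L : ℕ) (hL : L ≠ 0) (z : ℂ) : ev (PowerSeries.expand L hL P) z = ev P (L * z) := by
  have hi : Function.Injective (fun n : ℕ => L * n) := fun a b h => by simpa [hL] using h
  rw [ev, ev, qe_nat_mul, ← hi.tsum_eq]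
  · refine tsum_congr fun n => ?_
    simp [PowerSeries.coeff_expand, hL, pow_mul, Nat.mul_div_cancel_left _ (Nat.pos_of_ne_zero hL)]
  · intro n hn
    rw [Function.mem_support, PowerSeries.coeff_expand] at hn
    by_cases h : L ∣ n
    · obtain ⟨k, rfl⟩ := h; exact ⟨k, rfl⟩
    · simp [h] at hn

end MPC


namespace MPC
open PowerSeries Complex

/-- eta -/
noncomputable def eta (z : ℂ) : ℂ := qe (z / 24) * ev Eu z

lemma qe_half (k : ℤ) : qe (k / 2) = (((Int.negOnePow k : ℤˣ) : ℤ) : ℂ) := by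
  rcases Int.even_or_odd' k with ⟨a, rfl | rfl⟩
  · rw [Int.negOnePow_two_mul]
    rw [show (((2 * a : ℤ) : ℂ) / 2) = a by push_cast; ring, qe_int]; simp
  · rw [Int.negOnePow_two_mul_add_one]
    rw [show (((2 * a + 1 : ℤ) : ℂ) / 2) = 1 / 2 + a by push_cast; ring, qe_add_int, qe]
    rw [show (2 * (Real.pi : ℂ) * I * (1 / 2)) = Real.pi * I by ring, Complex.exp_pi_mul_I]; simp

lemma eta_hasSum {z : ℂ} (hz : 0 < z.im) :
    HasSum (fun k : ℤ => qe (k / 2 + (6 * k - 1) ^ 2 * z / 24)) (eta z) := by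
  have h := Conv_Eu.hasSum hz
  rw [← pentagonal_injective.hasSum_iff] at h
  · refine (h.mul_left (qe (z / 24))).congr_fun ?_ 
    intro k
    simp only [Function.comp]
    rw [Eu, coeff_pentagonalSeries_pentagonal, qe_add, qe_half, ← qe_nat_mul]
    rw [mul_left_comm, ← qe_add]
    have h2 := two_mul_natCast_pentagonal k
    have h3 : (2 * (pentagonal k : ℂ)) = k * (3 * k - 1) := by exact_mod_cast h2
    congr 2
    linear_combination (z / 2) * (-h3)
  · intro n hn
    rw [Eu, coeff_pentagonalSeries_eq_zero ℤ hn]; simp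

lemma term_qe (n : ℤ) (z τ : ℂ) : jacobiTheta₂_term n z τ = qe (n * z + n ^ 2 * τ / 2) := by
  rw [jacobiTheta₂_term, qe]; congr 1; ring

/-- reindexing of the integers -/
lemma reindex_bij (c : ℕ) [NeZero c] (c' k1 : ℤ) (hc : (c : ℤ) = 2 * c' + 1) :
    Function.Bijective fun p : ZMod c × ℤ => 2 * k1 + 2 * (p.1.val : ℤ) + c * p.2 := by
  have hcz : (2 * (c' : ZMod c) + 1) = 0 := by
    have := congrArg (fun a : ℤ => (a : ZMod c)) hc
    simpa using this.symm
  have hc0 : (c : ℤ) ≠ 0 := by simpa using NeZero.ne c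
  constructor
  · rintro ⟨g, j⟩ ⟨g', j'⟩ h
    simp only at h
    have h1 := congrArg (fun a : ℤ => (a : ZMod c)) h
    push_cast at h1
    simp only [ZMod.natCast_val, ZMod.cast_id, ZMod.natCast_self, zero_mul, add_zero] at h1
    have h2 : g = g' := by linear_combination (-(c' : ZMod c)) * h1 + (g - g') * hcz
    subst h2
    have : (c : ℤ) * j = c * j' := by linarith
    rw [mul_left_cancel₀ hc0 this]
  · intro k
    set g : ZMod c := ((k - 2 * k1 : ℤ) : ZMod c) * (c' + 1) with hg
    have h1 : ((k - 2 * k1 - 2 * (g.val : ℤ) : ℤ) : ZMod c) = 0 := by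
      push_cast
      simp only [ZMod.natCast_val, ZMod.cast_id]
      rw [hg]; push_cast
      linear_combination (-((k : ZMod c) - 2 * k1)) * hcz
    rw [ZMod.intCast_zmod_eq_zero_iff_dvd] at h1
    obtain ⟨j, hj⟩ := h1
    exact ⟨(g, j), by simp only; linarith⟩

/-- quadratic Gauss sum -/
noncomputable def GS (c : ℕ) [NeZero c] (a : ZMod c) : ℂ := ∑ g : ZMod c, ZMod.stdAddChar (a * g ^ 2)

lemma std_qe (c : ℕ) [NeZero c] (j : ℤ) : ZMod.stdAddChar (j : ZMod c) = qe (j / c) := by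
  rw [ZMod.stdAddChar_coe, qe]; congr 1; ring

lemma gauss_complete (c : ℕ) [NeZero c] (x y h : ℤ) (hu : IsUnit (12 : ZMod c))
    (hxy : (576 * x * y : ZMod c) = 1) :
    ∑ g : ZMod c, qe ((-144 * y * g.val ^ 2 + g.val * h) / c) = qe (x * h ^ 2 / c) * GS c (-y) := by
  have e1 : ∀ g : ZMod c, qe ((-144 * y * g.val ^ 2 + g.val * h) / c) =
      ZMod.stdAddChar (-144 * (y : ZMod c) * g ^ 2 + g * (h : ZMod c)) := by
    intro g
    have := std_qe c (-144 * y * g.val ^ 2 + g.val * h)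
    push_cast at this
    rw [← this]; simp
  have e2 : qe (x * h ^ 2 / c) = ZMod.stdAddChar ((x : ZMod c) * (h : ZMod c) ^ 2) := by
    have := std_qe c (x * h ^ 2); push_cast at this; rw [← this]
  simp_rw [e1]
  rw [e2, GS, Finset.mul_sum]
  obtain ⟨u, hu⟩ := hu
  refine Fintype.sum_equiv ((Equiv.subRight (2 * (x : ZMod c) * h)).trans (Units.mulLeft u)) _ _ fun g => ?_
  rw [← AddChar.map_add_eq_mul]
  congr 1
  simp only [Equiv.trans_apply, Equiv.subRight_apply, Units.mulLeft_apply, hu]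
  linear_combination (g * (h : ZMod c) - x * (h : ZMod c) ^ 2) * (-hxy)

end MPC


namespace MPC
open PowerSeries Complex

/-- square root factor -/
noncomputable def rt (w : ℂ) : ℂ := (-I * w) ^ (1 / 2 : ℂ)

lemma rt_mul (r : ℝ) (hr : 0 < r) (w : ℂ) (hw : w ≠ 0) : rt (r * w) = Real.sqrt r * rt w := by
  have h1 : -I * w ≠ 0 := by simp [hw]
  have h2 : -I * (r * w) = r * (-I * w) := by ring
  rw [rt, rt, h2, cpow_def_of_ne_zero (by simp [hr.ne', hw]), cpow_def_of_ne_zero h1, Complex.log_ofReal_mul hr h1,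
    add_mul, Complex.exp_add]
  congr 1
  rw [Real.sqrt_eq_rpow, Real.rpow_def_of_pos hr]; push_cast; rfl

lemma rt_sq (w : ℂ) : rt w ^ 2 = -I * w := by
  rw [rt, ← Complex.cpow_nat_mul]; simp

lemma rt_ne_zero {w : ℂ} (hw : w ≠ 0) : rt w ≠ 0 := by
  intro h; have := rt_sq w; rw [h] at this; simp [hw] at this

/-- cosine factor -/
noncomputable def lam (c : ℕ) : ℂ := qe (c / 12) + qe (-c / 12)

lemma hasSum_third (c : ℕ) (c' : ℤ) (hc : (c : ℤ) = 2 * c' + 1) {u : ℂ} (hu : 0 < u.im) :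
    HasSum (fun n : ℤ => qe (-c * (2 * n - 1) / 12 + (2 * n - 1) ^ 2 * u / 24)) (lam c * eta u) := by
  have hc2 : (c : ℂ) = 2 * c' + 1 := by exact_mod_cast hc
  have hs : Summable (fun n : ℤ => qe (-c * (2 * n - 1) / 12 + (2 * n - 1) ^ 2 * u / 24)) := by
    have h1 := (hasSum_jacobiTheta₂_term (-c / 6 - u / 6) (τ := u / 3) (by simpa using hu)).summable
    refine (h1.mul_left (qe (c / 12 + u / 24))).congr fun n => ?_
    rw [term_qe, ← qe_add]; congr 1; ring
  have h0 := hs.hasSum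
  have h1 := (Int.divModEquiv 3).symm.hasSum_iff.2 h0
  have h1' := (Equiv.prodComm (Fin 3) ℤ).hasSum_iff.2 h1
  have he := eta_hasSum hu
  let f : Fin 3 → ℂ := ![qe (c / 12) * eta u, qe (-c / 12) * eta u, 0]
  have h2 : HasSum f (∑' n : ℤ, qe (-c * (2 * n - 1) / 12 + (2 * n - 1) ^ 2 * u / 24)) := by
    refine h1'.prod_fiberwise fun i => ?_
    fin_cases i
    · refine (he.mul_left (qe (c / 12))).congr_fun fun k => ?_
      simp only [Function.comp, Int.divModEquiv_symm_apply, Equiv.prodComm_apply, Prod.swap]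
      rw [← qe_add]
      refine qe_eq_of_sub _ _ (-(c' + 1) * k) ?_
      push_cast; rw [hc2]; simp; ring
    · refine ((Equiv.neg ℤ).hasSum_iff.2 (he.mul_left (qe (-c / 12)))).congr_fun fun k => ?_
      simp only [Function.comp, Int.divModEquiv_symm_apply, Equiv.prodComm_apply, Prod.swap, Equiv.neg_apply]
      rw [← qe_add]
      refine qe_eq_of_sub _ _ (-c' * k) ?_
      push_cast; rw [hc2]; simp; ring
    · set φ : ℤ → ℂ := _
      change HasSum φ 0
      have hφs : Summable φ := h1'.summable.prod_factor _
      have hφ : ∀ k, φ (-1 - k) = - φ k := by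
        intro k
        simp only [φ, Function.comp, Int.divModEquiv_symm_apply, Equiv.prodComm_apply, Prod.swap]
        have h7 : ∀ a : ℂ, -qe a = qe (1 / 2 + a) := by
          intro a
          have := qe_half 1
          simp only [Int.cast_one, Int.negOnePow_one] at this
          rw [qe_add, this]; simp
        rw [h7]
        refine qe_eq_of_sub _ _ (c' + c * k) ?_
        push_cast; rw [hc2]; simp; ring
      have h3 := (Equiv.subLeft (-1 : ℤ)).tsum_eq φ
      have h4 : ∑' k, φ (-1 - k) = - ∑' k, φ k := by simp_rw [hφ]; rw [tsum_neg]
      have h5 : ∑' k, φ k = 0 := by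
        have h6 : ∑' k, φ (-1 - k) = ∑' k, φ k := h3
        rw [h4] at h6
        linear_combination (-1/2 : ℂ) * h6
      rw [← h5]; exact hφs.hasSum
  have h3 := (hasSum_fintype f).unique h2
  rw [← h3] at h0
  convert h0 using 1
  simp [f, Fin.sum_univ_three, lam]; ring

end MPC


namespace MPC
open PowerSeries Complex

lemma im_neg_inv {w : ℂ} (hw : 0 < w.im) : 0 < (-1 / w).im := by
  have h0 : w ≠ 0 := by rintro rfl; simp at hw
  rw [neg_div, one_div, Complex.neg_im, Complex.inv_im, neg_div, neg_neg]
  exact div_pos hw (Complex.normSq_pos.2 h0)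

lemma key0 (c : ℕ) [NeZero c] (c' k1 x y : ℤ) (hc : (c : ℤ) = 2 * c' + 1) (hk : 12 * k1 = 1 - (c : ℤ) ^ 2)
    (hu : IsUnit (12 : ZMod c)) (hxy : (576 * x * y : ZMod c) = 1) {w : ℂ} (hw : 0 < w.im) :
    eta ((w - 24 * y) / c) * rt (3 * c * w) = lam c * GS c (-y) * eta ((24 * x - 1 / w) / c) := by
  have hw0 : w ≠ 0 := by rintro rfl; simp at hw
  have hcp : (0 : ℝ) < c := by exact_mod_cast Nat.pos_of_ne_zero (NeZero.ne c)
  have hc0 : (c : ℂ) ≠ 0 := by exact_mod_cast NeZero.ne c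
  have hc2 : (c : ℂ) = 2 * c' + 1 := by exact_mod_cast hc
  have hk2 : (12 * (k1 : ℂ)) = 1 - c ^ 2 := by exact_mod_cast hk
  have him : 0 < ((w - 24 * y) / c).im := by
    rw [Complex.div_natCast_im]; apply div_pos _ hcp; simpa using hw
  have him2 : 0 < ((24 * x - 1 / w) / c).im := by
    rw [Complex.div_natCast_im]; apply div_pos _ hcp
    have := im_neg_inv hw
    rw [sub_eq_add_neg, ← neg_div]; simpa using this
  have hτ : 0 < (3 * c * w).im := by
    have : (3 * c * w).im = 3 * c * w.im := by
      rw [show (3 * c * w : ℂ) = ((3 * c : ℝ) : ℂ) * w by push_cast; ring, Complex.im_ofReal_mul]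
    rw [this]; positivity
  have hτ0 : 3 * c * w ≠ 0 := by simp [hc0, hw0]
  have hR : rt (3 * c * w) ≠ 0 := rt_ne_zero hτ0
  have h1 := (Equiv.ofBijective _ (reindex_bij c c' k1 hc)).hasSum_iff.2 (eta_hasSum him)
  have h2 : HasSum (fun g : ZMod c => qe (-144 * g.val ^ 2 * y / c + (12 * g.val - c ^ 2) ^ 2 * w / (24 * c)) *
      jacobiTheta₂ ((1 + (12 * g.val - c ^ 2) * w) / 2) (3 * c * w)) (eta ((w - 24 * y) / c)) := by
    refine h1.prod_fiberwise fun g => ?_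
    refine ((hasSum_jacobiTheta₂_term _ hτ).mul_left _).congr_fun fun j => ?_
    simp only [Function.comp, Equiv.ofBijective_apply]
    rw [term_qe, ← qe_add]
    refine qe_eq_of_sub _ _ (k1 + g.val + c' * j - y * (6 * j - c) * (24 * g.val - c ^ 2 + 6 * c * j)) ?_
    have hv : (6 * ((2 * k1 + 2 * (g.val : ℤ) + c * j : ℤ) : ℂ) - 1) = 12 * g.val - c ^ 2 + 6 * c * j := by
      push_cast; linear_combination hk2
    rw [hv]
    push_cast
    field_simp
    rw [hc2]
    ring
  have h3 : ∀ g : ZMod c, HasSum (fun n : ℤ => qe ((-144 * y * g.val ^ 2 + g.val * (2 * n - 1 : ℤ)) / c) *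
      qe (-c * (2 * n - 1) / 12 - (2 * n - 1) ^ 2 / (24 * c * w)))
      ((qe (-144 * g.val ^ 2 * y / c + (12 * g.val - c ^ 2) ^ 2 * w / (24 * c)) *
      jacobiTheta₂ ((1 + (12 * g.val - c ^ 2) * w) / 2) (3 * c * w)) * rt (3 * c * w)) := by
    intro g
    rw [jacobiTheta₂_functional_equation]
    have h4 := hasSum_jacobiTheta₂_term (((1 + (12 * g.val - c ^ 2) * w) / 2) / (3 * c * w)) (im_neg_inv hτ)
    set E := jacobiTheta₂ (((1 + (12 * g.val - c ^ 2) * w) / 2) / (3 * c * w)) (-1 / (3 * c * w))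
    have e1 : (qe (-144 * g.val ^ 2 * y / c + (12 * g.val - c ^ 2) ^ 2 * w / (24 * c)) *
      (1 / (-I * (3 * c * w)) ^ (1 / 2 : ℂ) * cexp (-Real.pi * I * ((1 + (12 * g.val - c ^ 2) * w) / 2) ^ 2 / (3 * c * w)) * E)) * rt (3 * c * w) = (qe (-144 * g.val ^ 2 * y / c + (12 * g.val - c ^ 2) ^ 2 * w / (24 * c)) *
        qe (-((1 + (12 * g.val - c ^ 2) * w) / 2) ^ 2 / (2 * (3 * c * w)))) * E := by
      have : cexp (-Real.pi * I * ((1 + (12 * g.val - c ^ 2) * w) / 2) ^ 2 / (3 * c * w)) = qe (-((1 + (12 * g.val - c ^ 2) * w) / 2) ^ 2 / (2 * (3 * c * w))) := by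
        rw [qe]; congr 1; field_simp
      rw [this, ← rt]
      have hg : ∀ a b e R : ℂ, R ≠ 0 → a * (1 / R * b * e) * R = a * b * e := by
        intro a b e R hR; field_simp
      exact hg _ _ _ _ hR
    rw [e1]
    refine (h4.mul_left _).congr_fun fun n => ?_
    rw [term_qe, ← qe_add, ← qe_add, ← qe_add]
    congr 1
    push_cast
    field_simp
    ring
  have h5 := hasSum_sum (s := Finset.univ) (fun g _ => h3 g)
  rw [← Finset.sum_mul, (hasSum_fintype _).unique h2] at h5
  have h6 := ((hasSum_third c c' hc him2).mul_left (GS c (-y)))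
  have h7 := h5.unique (h6.congr_fun fun n => ?_)
  · rw [h7]; ring
  · rw [← Finset.sum_mul, gauss_complete c x y _ hu hxy, mul_right_comm, ← qe_add, mul_comm]
    congr 2
    push_cast
    field_simp
    ring

end MPC


namespace MPC
open PowerSeries Complex

lemma lam_one : lam 1 = Real.sqrt 3 := by
  have h : lam 1 = 2 * Complex.cos (Real.pi / 6) := by
    rw [Complex.two_cos, lam, qe, qe]
    congr 2 <;> push_cast <;> ring
  rw [h, ← Complex.ofReal_ofNat, ← Complex.ofReal_ofNat, ← Complex.ofReal_div, ← Complex.ofReal_cos, Real.cos_pi_div_six,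
    ← Complex.ofReal_mul]
  congr 1; ring

lemma lam_add (c a : ℕ) : lam (12 * a + c) = lam c := by
  rw [lam, lam]
  congr 1
  · exact qe_eq_of_sub _ _ a (by push_cast; ring)
  · exact qe_eq_of_sub _ _ (-a) (by push_cast; ring)

lemma lam_sq (c : ℕ) (h2 : c % 2 = 1) (h3 : c % 3 ≠ 0) : lam c ^ 2 = 3 := by
  have h1 : lam 1 ^ 2 = 3 := by
    rw [lam_one, ← Complex.ofReal_pow, Real.sq_sqrt (by norm_num)]; norm_num
  have key : ∀ c : ℕ, lam c ^ 2 = qe (c / 6) + qe (-c / 6) + 2 := by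
    intro c
    have e1 : qe (c / 12) * qe (c / 12) = qe (c / 6) := by rw [← qe_add]; congr 1; ring
    have e2 : qe (-c / 12) * qe (-c / 12) = qe (-c / 6) := by rw [← qe_add]; congr 1; ring
    have e3 : qe (c / 12) * qe (-c / 12) = 1 := by rw [← qe_add, ← qe_zero]; congr 1; ring
    rw [lam]; linear_combination e1 + e2 + 2 * e3
  rw [← h1, key, key]
  have hc : c % 6 = 1 ∨ c % 6 = 5 := by omega
  rcases hc with hc | hc
  · obtain ⟨a, rfl⟩ : ∃ a, c = 6 * a + 1 := ⟨c / 6, by omega⟩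
    congr 2
    · exact qe_eq_of_sub _ _ a (by push_cast; ring)
    · exact qe_eq_of_sub _ _ (-a) (by push_cast; ring)
  · obtain ⟨a, rfl⟩ : ∃ a, c = 6 * a + 5 := ⟨c / 6, by omega⟩
    congr 1
    rw [add_comm]
    congr 1
    · exact qe_eq_of_sub _ _ (-a-1) (by push_cast; ring)
    · exact qe_eq_of_sub _ _ (a+1) (by push_cast; ring)

/-- normalized sign -/
noncomputable def kap (c : ℕ) : ℂ := lam c / Real.sqrt 3

lemma sqrt3_ne : (Real.sqrt 3 : ℂ) ≠ 0 := by simp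
lemma sqrt3_sq : (Real.sqrt 3 : ℂ) ^ 2 = 3 := by rw [← Complex.ofReal_pow, Real.sq_sqrt (by norm_num)]; norm_num

lemma kap_sq (c : ℕ) (h2 : c % 2 = 1) (h3 : c % 3 ≠ 0) : kap c ^ 2 = 1 := by
  rw [kap, div_pow, lam_sq c h2 h3, sqrt3_sq]; norm_num

lemma key (c : ℕ) [NeZero c] (x y : ℤ) (h2 : c % 2 = 1) (h3 : c % 3 ≠ 0)
    (hxy : (576 * x * y : ZMod c) = 1) {w : ℂ} (hw : 0 < w.im) :
    eta ((w - 24 * y) / c) * (Real.sqrt c * rt w) = kap c * GS c (-y) * eta ((24 * x - 1 / w) / c) := by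
  have hw0 : w ≠ 0 := by rintro rfl; simp at hw
  have hcp : (0 : ℝ) < c := by exact_mod_cast Nat.pos_of_ne_zero (NeZero.ne c)
  have hu : IsUnit (12 : ZMod c) := IsUnit.of_mul_eq_one (48 * x * y) (by rw [← hxy]; ring)
  have hk : ∃ k1 : ℤ, 12 * k1 = 1 - (c : ℤ) ^ 2 := by
    have hc : c % 6 = 1 ∨ c % 6 = 5 := by omega
    rcases hc with hc | hc
    · obtain ⟨a, rfl⟩ : ∃ a, c = 6 * a + 1 := ⟨c / 6, by omega⟩
      exact ⟨-(3 * a ^ 2 + a), by push_cast; ring⟩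
    · obtain ⟨a, rfl⟩ : ∃ a, c = 6 * a + 5 := ⟨c / 6, by omega⟩
      exact ⟨-(3 * a ^ 2 + 5 * a + 2), by push_cast; ring⟩
  obtain ⟨k1, hk⟩ := hk
  have h := key0 c ((c / 2 : ℕ) : ℤ) k1 x y (by omega) hk hu hxy hw
  have e : rt (3 * c * w) = Real.sqrt 3 * (Real.sqrt c * rt w) := by
    rw [show (3 * c * w : ℂ) = ((3 : ℝ) : ℂ) * (((c : ℝ) : ℂ) * w) by push_cast; ring, rt_mul 3 (by norm_num) _
      (mul_ne_zero (by simpa using hcp.ne') hw0), rt_mul _ hcp _ hw0]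
  rw [e] at h
  rw [kap]
  have h5 := sqrt3_ne
  refine mul_left_cancel₀ h5 ?_
  have h6 : (Real.sqrt 3 : ℂ) * (lam c / Real.sqrt 3) = lam c := by field_simp
  linear_combination h - (GS c (-y) * eta ((24 * x - 1 / w) / c)) * h6

lemma key1 {w : ℂ} (hw : 0 < w.im) : eta (-1 / w) = rt w * eta w := by
  have h := key 1 0 0 (by norm_num) (by norm_num) (Subsingleton.elim _ _) hw
  have hg : GS 1 (-(0 : ℤ)) = 1 := by
    rw [GS, Fintype.sum_eq_single 0 (fun g hg => absurd (Subsingleton.elim _ _) hg)]; simp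
  rw [hg] at h
  have hk : kap 1 = 1 := by rw [kap, lam_one, div_self sqrt3_ne]
  rw [hk] at h
  simp at h
  rw [neg_div, one_div, ← h]; ring

lemma sum_range_qe (L : ℕ) (hL : 0 < L) (a : ℤ) :
    ∑ h ∈ Finset.range L, qe (a * h / L) = if (L : ℤ) ∣ a then (L : ℂ) else 0 := by
  have hL0 : (L : ℂ) ≠ 0 := by exact_mod_cast hL.ne'
  have e : ∀ h : ℕ, qe (a * h / L) = qe (a / L) ^ h := by
    intro h; rw [← qe_nat_mul]; congr 1; ring
  simp_rw [e]
  split_ifs with hd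
  · obtain ⟨b, rfl⟩ := hd
    have : qe (((L * b : ℤ) : ℂ) / L) = 1 := by
      rw [show (((L * b : ℤ) : ℂ) / L) = b by push_cast; field_simp, qe_int]
    rw [this]; simp
  · have h1 : qe (a / L) ≠ 1 := by
      intro h
      rw [qe, Complex.exp_eq_one_iff] at h
      obtain ⟨n, hn⟩ := h
      apply hd
      refine ⟨n, ?_⟩
      have h2 : (2 * Real.pi * I) * (a / L : ℂ) = (2 * Real.pi * I) * n := by rw [hn]; ring
      have h3 := mul_left_cancel₀ Complex.two_pi_I_ne_zero h2
      field_simp at h3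
      exact_mod_cast h3
    have h2 := geom_sum_eq h1 L
    rw [h2, ← qe_nat_mul, show ((L : ℂ) * (a / L)) = a by field_simp, qe_int]; simp

lemma GS_sq (l : ℕ) [NeZero (l ^ 2)] (hl : l.Prime) (h2 : l ≠ 2) (a : ℤ) (ha : ¬ (l : ℤ) ∣ a) :
    GS (l ^ 2) a = l := by
  have hl0 : (l : ℂ) ≠ 0 := by exact_mod_cast hl.ne_zero
  have e1 : ∀ h : ℕ, GS (l ^ 2) a = ∑ g : ZMod (l ^ 2), ZMod.stdAddChar ((a : ZMod (l^2)) * (g + (l : ZMod (l^2)) * (h : ZMod (l^2))) ^ 2) := by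
    intro h
    rw [GS]
    exact (Fintype.sum_equiv (Equiv.addRight ((l : ZMod (l^2)) * h)) _ _ fun g => rfl).symm
  have e2 : ∀ (g : ZMod (l^2)) (h : ℕ), ZMod.stdAddChar ((a : ZMod (l^2)) * (g + (l : ZMod (l^2)) * (h : ZMod (l^2))) ^ 2) =
      qe (a * g.val ^ 2 / (l ^ 2 : ℕ)) * qe ((2 * a * g.val : ℤ) * h / l) := by
    intro g h
    have := std_qe (l ^ 2) (a * (g.val + l * h) ^ 2)
    push_cast at this
    rw [ZMod.natCast_val, ZMod.cast_id] at this
    rw [this, ← qe_add]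
    refine qe_eq_of_sub _ _ (a * h ^ 2) ?_
    push_cast; field_simp; ring
  have e3 : (l : ℂ) * GS (l ^ 2) a = ∑ h ∈ Finset.range l, GS (l ^ 2) a := by simp
  have e4 : ∑ h ∈ Finset.range l, GS (l ^ 2) a = ∑ g : ZMod (l^2), if l ∣ g.val then (l : ℂ) else 0 := by
    rw [Finset.sum_congr rfl fun h _ => e1 h, Finset.sum_comm]
    refine Finset.sum_congr rfl fun g _ => ?_
    simp_rw [e2]
    rw [← Finset.mul_sum, sum_range_qe l hl.pos]
    have hp : Prime (l : ℤ) := Nat.prime_iff_prime_int.1 hl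
    have : (l : ℤ) ∣ 2 * a * g.val ↔ l ∣ g.val := by
      constructor
      · intro h
        rcases hp.dvd_or_dvd h with h | h
        · rcases hp.dvd_or_dvd h with h | h
          · exfalso
            have : l ∣ 2 := by exact_mod_cast h
            exact h2 ((Nat.prime_dvd_prime_iff_eq hl Nat.prime_two).1 this)
          · exact absurd h ha
        · exact_mod_cast h
      · intro h; exact Dvd.dvd.mul_left (by exact_mod_cast h) _
    simp only [this]
    split_ifs with h
    · obtain ⟨b, hb⟩ := h
      rw [hb, show ((a : ℂ) * ((l * b : ℕ) : ℂ) ^ 2 / (l ^ 2 : ℕ)) = ((a * b ^ 2 : ℤ) : ℂ) by push_cast; field_simp, qe_int, one_mul]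
    · simp
  have e5 : ∑ g : ZMod (l^2), (if l ∣ g.val then (l : ℂ) else 0) = ∑ n ∈ Finset.range (l ^ 2), if l ∣ n then (l : ℂ) else 0 := by
    refine Finset.sum_bij (fun g _ => g.val) (fun g _ => by simpa using ZMod.val_lt g) (fun g _ g' _ h => ZMod.val_injective _ h)
      (fun n hn => ⟨(n : ZMod (l^2)), Finset.mem_univ _, ZMod.val_cast_of_lt (by simpa using hn)⟩) (fun _ _ => rfl)
  have e6 : ∑ n ∈ Finset.range (l ^ 2), (if l ∣ n then (l : ℂ) else 0) = l * l := by
    have h7 : ∀ N : ℕ, ∑ n ∈ Finset.range (l * N), (if l ∣ n then (l : ℂ) else 0) = N * l := by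
      intro N
      induction N with
      | zero => simp
      | succ N ih =>
        rw [mul_add, mul_one, Finset.sum_range_add, ih, Finset.sum_eq_single_of_mem 0 (by simpa using hl.pos)]
        · simp; ring
        · intro i hi hi0
          rw [if_neg]
          rw [Nat.dvd_add_right (Dvd.intro _ rfl)]
          intro hd; exact absurd (Nat.le_of_dvd (by omega) hd) (by simpa using hi)
    rw [pow_two, h7]
  rw [e4, e5, e6] at e3
  exact mul_left_cancel₀ hl0 e3

end MPC


namespace MPC
open PowerSeries Complex

lemma keyl2 (l : ℕ) (hl : l.Prime) (h2 : l ≠ 2) (h3 : l ≠ 3) (x y : ℤ) (hxy : ((l : ℤ) ^ 2) ∣ 576 * x * y - 1)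
    {w : ℂ} (hw : 0 < w.im) : eta ((24 * x - 1 / w) / l ^ 2) = rt w * eta ((w - 24 * y) / l ^ 2) := by
  have hl0 : (l : ℂ) ≠ 0 := by exact_mod_cast hl.ne_zero
  haveI : NeZero (l ^ 2) := ⟨pow_ne_zero _ hl.ne_zero⟩
  have m2 : l % 2 = 1 := hl.mod_two_eq_one_iff_ne_two.2 h2
  have m3 : l % 3 ≠ 0 := by
    intro h
    exact h3 ((Nat.prime_dvd_prime_iff_eq Nat.prime_three hl).1 (Nat.dvd_of_mod_eq_zero h)).symm
  have hz : (576 * x * y : ZMod (l ^ 2)) = 1 := by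
    rw [← sub_eq_zero]
    have := (ZMod.intCast_zmod_eq_zero_iff_dvd (576 * x * y - 1) (l ^ 2)).2 (by exact_mod_cast hxy)
    exact_mod_cast this
  have hq : ∃ a, l ^ 2 = 12 * a + 1 := by
    have : l % 12 = 1 ∨ l % 12 = 5 ∨ l % 12 = 7 ∨ l % 12 = 11 := by omega
    have h4 : l ^ 2 % 12 = 1 := by
      rcases this with h | h | h | h <;> simp [Nat.pow_mod, h]
    exact ⟨l ^ 2 / 12, by omega⟩
  obtain ⟨a, ha⟩ := hq
  have h := key (l ^ 2) x y (by omega) (by omega) hz hw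
  have hk : kap (l ^ 2) = 1 := by rw [ha, kap, lam_add, lam_one, div_self sqrt3_ne]
  have hg : GS (l ^ 2) (-(y : ZMod (l ^ 2))) = l := by
    have := GS_sq l hl h2 (-y) ?_
    · push_cast at this; exact this
    · intro hd
      have h4 : (l : ℤ) ∣ 576 * x * y - 1 := (dvd_pow_self _ two_ne_zero).trans hxy
      have h5 : (l : ℤ) ∣ 1 := by
        have := dvd_sub (Dvd.dvd.mul_left ((dvd_neg).1 hd) (576 * x)) h4
        simpa using this
      have := Int.eq_one_of_dvd_one (by positivity) h5
      exact hl.one_lt.ne' (by exact_mod_cast this)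
  have hs : (Real.sqrt ((l ^ 2 : ℕ) : ℝ) : ℂ) = l := by
    push_cast; rw [Real.sqrt_sq (by positivity)]; simp
  rw [hk, hg, hs] at h
  push_cast at h
  apply mul_left_cancel₀ hl0
  linear_combination -h

/-- complex quadratic character -/
noncomputable def chi (l : ℕ) [Fact l.Prime] : MulChar (ZMod l) ℂ := (quadraticChar (ZMod l)).ringHomComp (Int.castRingHom ℂ)

lemma chi_apply (l : ℕ) [Fact l.Prime] (a : ZMod l) : chi l a = (quadraticChar (ZMod l) a : ℂ) := rfl

/-- Gauss sum -/
noncomputable def gau (l : ℕ) [Fact l.Prime] : ℂ := gaussSum (chi l) ZMod.stdAddChar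

variable (l : ℕ) [hlF : Fact l.Prime]

lemma chi_quad : (chi l).IsQuadratic := (quadraticChar_isQuadratic (ZMod l)).comp _

lemma chi_sq {a : ZMod l} (ha : a ≠ 0) : chi l a ^ 2 = 1 := by
  rw [chi_apply]; exact_mod_cast quadraticChar_sq_one ha

lemma chi_ne_one (h2 : l ≠ 2) : chi l ≠ 1 := by
  have hc : ringChar (ZMod l) ≠ 2 := by rwa [ZMod.ringChar_zmod_n]
  obtain ⟨a, ha⟩ := quadraticChar_exists_neg_one hc
  intro h
  have h1 := congrArg (fun f : MulChar (ZMod l) ℂ => f a) h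
  simp only [chi_apply, ha] at h1
  have h0 : IsUnit a := by
    rw [isUnit_iff_ne_zero]; rintro rfl; simp at ha
  rw [MulChar.one_apply h0] at h1
  norm_num at h1

lemma gau_sq (h2 : l ≠ 2) : gau l ^ 2 = chi l (-1) * l := by
  rw [gau, gaussSum_sq (chi_ne_one l h2) (chi_quad l) (ZMod.isPrimitive_stdAddChar l), ZMod.card]

lemma gau_shift (a : ZMod l) (ha : a ≠ 0) : ∑ b : ZMod l, chi l b * ZMod.stdAddChar (a * b) = chi l a * gau l := by
  have h := gaussSum_mulShift (chi l) (ZMod.stdAddChar (N := l)) (Units.mk0 a ha)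
  simp only [Units.val_mk0] at h
  rw [gau, ← h, ← mul_assoc, ← pow_two, chi_sq l ha, one_mul, gaussSum]
  rfl

lemma sum_std (a : ZMod l) (ha : a ≠ 0) : ∑ b : ZMod l, ZMod.stdAddChar (a * b) = 0 := by
  have h := AddChar.sum_eq_zero_of_ne_one ((ZMod.isPrimitive_stdAddChar l) ha)
  exact h

lemma gau_shift' (h2 : l ≠ 2) (a : ZMod l) : ∑ b : ZMod l, chi l b * ZMod.stdAddChar (a * b) = chi l a * gau l := by
  by_cases ha : a = 0
  · subst ha
    simp only [zero_mul, AddChar.map_zero_eq_one, mul_one]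
    rw [MulChar.sum_eq_zero_of_ne_one (chi_ne_one l h2)]
    simp [chi_apply]
  · exact gau_shift l a ha

lemma GS_prime (h2 : l ≠ 2) (a : ZMod l) (ha : a ≠ 0) : GS l a = chi l a * gau l := by
  have hc : ringChar (ZMod l) ≠ 2 := by rwa [ZMod.ringChar_zmod_n]
  have h1 : GS l a = ∑ b : ZMod l, (chi l b + 1) * ZMod.stdAddChar (a * b) := by
    rw [GS, ← Finset.sum_fiberwise_of_maps_to (s := Finset.univ) (t := Finset.univ) (g := fun g : ZMod l => g ^ 2) (fun _ _ => Finset.mem_univ _)]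
    refine Finset.sum_congr rfl fun b _ => ?_
    rw [Finset.sum_congr rfl (g := fun _ => (ZMod.stdAddChar (a * b) : ℂ)), Finset.sum_const, nsmul_eq_mul]
    · congr 1
      have := quadraticChar_card_sqrts hc b
      rw [chi_apply]
      have h3 : ((Finset.univ.filter fun i : ZMod l => i ^ 2 = b).card : ℤ) = quadraticChar (ZMod l) b + 1 := by
        rw [← this]; congr 2; ext i; simp
      exact_mod_cast h3
    · intro i hi; rw [(Finset.mem_filter.1 hi).2]
  rw [h1]
  simp_rw [add_mul, one_mul]
  rw [Finset.sum_add_distrib, gau_shift l a ha, sum_std l a ha, add_zero]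

lemma keyl (h2 : l ≠ 2) (h3 : l ≠ 3) (x y : ℤ) (hxy : (576 * x * y : ZMod l) = 1)
    {w : ℂ} (hw : 0 < w.im) : eta ((24 * x - 1 / (l * w)) / l) = kap l * chi l y * gau l * rt w * eta (w - 24 * y / l) := by
  have hl := hlF.out
  have hl0 : (l : ℂ) ≠ 0 := by exact_mod_cast hl.ne_zero
  have hw0 : w ≠ 0 := by rintro rfl; simp at hw
  have m2 : l % 2 = 1 := hl.mod_two_eq_one_iff_ne_two.2 h2
  have m3 : l % 3 ≠ 0 := by
    intro h
    exact h3 ((Nat.prime_dvd_prime_iff_eq Nat.prime_three hl).1 (Nat.dvd_of_mod_eq_zero h)).symm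
  have hlp : (0 : ℝ) < l := by exact_mod_cast hl.pos
  have hlw : 0 < (l * w).im := by
    rw [← Complex.ofReal_natCast, Complex.im_ofReal_mul]; positivity
  have hy : (-(y : ZMod l)) ≠ 0 := by
    intro h; rw [neg_eq_zero] at h; simp [h] at hxy
  have h := key l x y m2 m3 hxy hlw
  rw [GS_prime l h2 _ hy] at h
  have e1 : (l * w - 24 * y) / l = w - 24 * y / l := by field_simp
  have e2 : (Real.sqrt l : ℂ) * rt (l * w) = l * rt w := by
    rw [← Complex.ofReal_natCast, rt_mul _ hlp _ hw0, ← mul_assoc, ← Complex.ofReal_mul, Real.mul_self_sqrt hlp.le]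
  rw [e1, e2] at h
  have e3 := gau_sq l h2
  have e4 := kap_sq l m2 m3
  have e5 : chi l (-(y : ZMod l)) = chi l (-1) * chi l y := by rw [← map_mul]; simp
  have e6 := chi_sq l hy
  have e7 : chi l (-1) ^ 2 = 1 := chi_sq l (by simp)
  have e8 : chi l y ^ 2 = 1 := chi_sq l (by simpa using hy)
  rw [e5] at h
  apply mul_left_cancel₀ hl0
  set E := eta ((24 * x - 1 / (l * w)) / l)
  have e9 : (kap l * (chi l (-1) * chi l y * gau l)) * (kap l * (chi l y * gau l)) = l := by
    linear_combination (chi l (-1) * chi l y ^ 2 * gau l ^ 2) * e4 + (chi l (-1) * gau l ^ 2) * e8 + chi l (-1) * e3 + l * e7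
  linear_combination (-E) * e9 - (kap l * (chi l y * gau l)) * h
end MPC


namespace MPC
open PowerSeries Complex

/-- level one modular form of weight s with integer coefficients -/
def MF (s : ℕ) (P : ℤ⟦X⟧) : Prop := Conv P ∧ ∀ z : ℂ, 0 < z.im → ev P (-1 / z) = z ^ s * ev P z

lemma MF.add {s : ℕ} {P Q : ℤ⟦X⟧} (hP : MF s P) (hQ : MF s Q) : MF s (P + Q) :=
  ⟨hP.1.add hQ.1, fun z hz => by
    rw [ev_add hP.1 hQ.1 (im_neg_inv hz), ev_add hP.1 hQ.1 hz, hP.2 z hz, hQ.2 z hz]; ring⟩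

lemma MF.const_mul {s : ℕ} {P : ℤ⟦X⟧} (c : ℤ) (hP : MF s P) : MF s (C c * P) :=
  ⟨hP.1.const_mul c, fun z hz => by rw [ev_C_mul, ev_C_mul, hP.2 z hz]; ring⟩

lemma MF.sub {s : ℕ} {P Q : ℤ⟦X⟧} (hP : MF s P) (hQ : MF s Q) : MF s (P - Q) := by
  have := hP.add (hQ.const_mul (-1)); simpa [sub_eq_add_neg] using this

lemma MF.mul {s t : ℕ} {P Q : ℤ⟦X⟧} (hP : MF s P) (hQ : MF t Q) : MF (s + t) (P * Q) :=
  ⟨hP.1.mul hQ.1, fun z hz => by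
    rw [ev_mul hP.1 hQ.1 (im_neg_inv hz), ev_mul hP.1 hQ.1 hz, hP.2 z hz, hQ.2 z hz]; ring⟩

lemma MF.one : MF 0 1 := ⟨.one, fun z _ => by simp [ev_one]⟩

lemma MF.pow {s : ℕ} {P : ℤ⟦X⟧} (hP : MF s P) (n : ℕ) : MF (s * n) (P ^ n) := by
  induction n with
  | zero => simpa using MF.one
  | succ n ih => rw [pow_succ, mul_add, mul_one]; exact ih.mul hP

/-- Delta -/
noncomputable def Dl : ℤ⟦X⟧ := X * Eu ^ 24

lemma Conv_Dl : Conv Dl := Conv.X.mul (Conv_Eu.pow _)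

lemma ev_Dl {z : ℂ} (hz : 0 < z.im) : ev Dl z = eta z ^ 24 := by
  rw [Dl, ev_mul Conv.X (Conv_Eu.pow _) hz, ev_pow Conv_Eu _ hz, ev_X, eta, mul_pow, ← qe_nat_mul]
  congr 2; push_cast; ring

lemma eta_ne_zero' {z : ℂ} (hz : 0 < z.im) : eta z ≠ 0 := mul_ne_zero (qe_ne_zero _) (ev_Eu_ne_zero hz)

lemma MF_Dl : MF 12 Dl := ⟨Conv_Dl, fun z hz => by
  rw [ev_Dl (im_neg_inv hz), ev_Dl hz, key1 hz, mul_pow, show 24 = 2 * 12 by norm_num, pow_mul (rt z), rt_sq, mul_pow]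
  have : (-I) ^ 12 = 1 := by rw [show 12 = 2 * 6 by norm_num, pow_mul, neg_sq, I_sq]; norm_num
  rw [this, one_mul]⟩

lemma ev_diff {P : ℤ⟦X⟧} (hP : Conv P) : DifferentiableOn ℂ (ev P) {z | 0 < z.im} := by
  let f : ℂ → ℂ := fun q => ∑' n, ((coeff n P : ℤ) : ℂ) * q ^ n
  have h1 : HasFPowerSeriesOnBall f (.ofScalars ℂ fun n => ((coeff n P : ℤ) : ℂ)) 0 1 := by
    constructor
    · refine le_of_forall_lt_imp_le_of_dense fun r hr ↦ ?_
      rcases eq_or_ne r 0 with rfl | hr'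
      · simp
      · lift r to NNReal using hr.ne_top
        apply FormalMultilinearSeries.le_radius_of_summable
        have h0 : 0 < (r : ℝ) := by
          have : r ≠ 0 := by exact_mod_cast hr'
          positivity
        have := hP r h0 (by exact_mod_cast hr)
        refine this.congr fun n => ?_
        simp [FormalMultilinearSeries.ofScalars_norm]
    · simp
    · intro y hy
      rw [← ENNReal.coe_one, Metric.eball_coe, NNReal.coe_one, mem_ball_zero_iff] at hy
      rw [zero_add]
      have hs : Summable fun n => ((coeff n P : ℤ) : ℂ) * y ^ n := by
        by_cases hy0 : y = 0
        · subst hy0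
          exact summable_of_ne_finset_zero (s := {0}) (fun n hn => by simp at hn; simp [hn])
        · refine Summable.of_norm ((hP ‖y‖ (norm_pos_iff.2 hy0) hy).congr fun n => ?_)
          rw [norm_mul, norm_pow, Complex.norm_intCast]
      have := hs.hasSum
      refine this.congr_fun fun n => ?_
      simp [mul_comm]
  have h2 := h1.differentiableOn
  have h3 : ev P = f ∘ qe := rfl
  rw [h3]
  refine h2.comp ?_ ?_
  · have : Differentiable ℂ qe := by unfold qe; fun_prop
    exact this.differentiableOn
  · intro z hz
    rw [← ENNReal.coe_one, Metric.eball_coe, NNReal.coe_one, mem_ball_zero_iff]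
    exact norm_qe_lt hz

open UpperHalfPlane ModularForm MatrixGroups Manifold Matrix.SpecialLinearGroup in
lemma MF.slash {s : ℕ} {P : ℤ⟦X⟧} (hP : MF s P) (γ : SL(2, ℤ)) :
    (fun τ : UpperHalfPlane => ev P τ) ∣[(s : ℤ)] γ = fun τ : UpperHalfPlane => ev P τ := by
  refine SlashInvariantForm.slash_action_generators_SL2Z ?_ ?_ γ
  · ext z
    rw [SL_slash_apply, UpperHalfPlane.modular_S_smul]
    have := hP.2 z z.2
    have hz := z.ne_zero
    rw [ModularGroup.denom_apply]; simp [ModularGroup.S]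
    rw [show -(z : ℂ)⁻¹ = -1 / z by ring, this]
    field_simp
  · ext z
    rw [SL_slash_apply, ModularGroup.denom_apply, modular_T_smul, ModularGroup.T]
    simp
    have := ev_add_int P z 1
    rw [add_comm]; simpa using this

open UpperHalfPlane ModularForm MatrixGroups Manifold Matrix.SpecialLinearGroup in
lemma MF.trans {s : ℕ} {P : ℤ⟦X⟧} (hP : MF s P) (c : ℕ) (hc : 0 < c) (x y : ℤ) (hxy : (c : ℤ) ∣ x * y - 1)
    {w : ℂ} (hw : 0 < w.im) : ev P ((x - 1 / w) / c) = w ^ s * ev P ((w - y) / c) := by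
  obtain ⟨d, hd⟩ := hxy
  have hc0 : (c : ℂ) ≠ 0 := by exact_mod_cast hc.ne'
  have hw0 : w ≠ 0 := by rintro rfl; simp at hw
  have hcp : (0 : ℝ) < c := by exact_mod_cast hc
  let γ : SL(2, ℤ) := ⟨!![x, d; (c : ℤ), y], by rw [Matrix.det_fin_two_of]; linarith⟩
  let τ : ℍ := ⟨(w - y) / c, by rw [Complex.div_natCast_im]; apply div_pos _ hcp; simpa using hw⟩
  have hτ : (τ : ℂ) = (w - y) / c := rfl
  have h := congrFun (hP.slash γ) τ
  rw [SL_slash_apply, UpperHalfPlane.specialLinearGroup_apply] at h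
  have hd2 : ((x : ℂ) * y - 1) = c * d := by exact_mod_cast hd
  rw [ModularGroup.denom_apply] at h; simp [γ] at h
  rw [hτ] at h
  have e1 : (c : ℂ) * ((w - y) / c) + y = w := by field_simp; ring
  have e2 : (x * ((w - y) / c) + d) / w = (x - 1 / w) / (c : ℂ) := by
    field_simp; linear_combination -hd2
  rw [e1, e2] at h
  rw [← h]; field_simp

end MPC


namespace MPC
open PowerSeries Complex

lemma qParam_one (z : ℂ) : Function.Periodic.qParam 1 z = qe z := by
  simp [Function.Periodic.qParam, qe]

open UpperHalfPlane ModularForm MatrixGroups Manifold Matrix.SpecialLinearGroup in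
lemma ev_hasSum_qParam {P : ℤ⟦X⟧} (hP : Conv P) (τ : ℍ) :
    HasSum (fun m ↦ ((coeff m P : ℤ) : ℂ) • Function.Periodic.qParam 1 τ ^ m) (ev P τ) := by
  simpa [qParam_one] using hP.hasSum τ.2

open UpperHalfPlane ModularForm MatrixGroups Manifold Matrix.SpecialLinearGroup in
/-- the modular form attached to a series -/
noncomputable def toMF {s : ℕ} {P : ℤ⟦X⟧} (hP : MF s P) : ModularForm 𝒮ℒ s where
  toFun τ := ev P τ
  slash_action_eq' := fun _ ⟨γ, hγ⟩ ↦ hγ ▸ hP.slash γ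
  holo' := by
    rw [UpperHalfPlane.mdifferentiable_iff]
    refine (ev_diff hP.1).congr fun z hz => ?_
    simp [UpperHalfPlane.ofComplex_apply_of_im_pos hz]
  bdd_at_cusps' {c} hc := by
    rw [Subgroup.IsArithmetic.isCusp_iff_isCusp_SL2Z] at hc
    rw [OnePoint.isBoundedAt_iff_forall_SL2Z hc]
    intro γ _
    rw [hP.slash γ]
    exact UpperHalfPlane.isBoundedAtImInfty_of_hasSum_qExpansion (h := 1) one_pos (ev_hasSum_qParam hP.1)

open UpperHalfPlane ModularForm MatrixGroups Manifold Matrix.SpecialLinearGroup in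
lemma MF.zero_const {P : ℤ⟦X⟧} (hP : MF 0 P) : P = C (constantCoeff P) := by
  obtain ⟨c, hc⟩ := ModularFormClass.levelOne_weight_zero_const (toMF hP)
  have h1 : ∀ τ : ℍ, ev P τ = c := fun τ => congrFun hc τ
  have u1 := fun m => ModularFormClass.qExpansion_coeff_unique (h := 1) one_pos (by simp) (f := toMF hP)
    (ev_hasSum_qParam hP.1) m
  have u2 := fun m => ModularFormClass.qExpansion_coeff_unique (h := 1) one_pos (by simp) (f := toMF hP)
    (c := fun m => if m = 0 then c else 0) (fun τ => by
      have : toMF hP τ = c := h1 τ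
      rw [this]
      convert hasSum_ite_eq (0 : ℕ) c using 2 with m
      split_ifs with h <;> simp [h]) m
  ext m
  have := (u1 m).trans (u2 m).symm
  rw [coeff_C]
  split_ifs with h
  · subst h; simp
  · simpa [h] using this

/-- Eisenstein series of weight 4 -/
noncomputable def E4 : ℤ⟦X⟧ := PowerSeries.mk fun n => if n = 0 then 1 else 240 * (ArithmeticFunction.sigma 3 n : ℤ)

lemma Conv_E4 : Conv E4 := by
  have h1 : Conv (PowerSeries.mk fun n => (ArithmeticFunction.sigma 3 n : ℤ)) := by
    refine Conv.of_poly 4 1 fun n => ?_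
    simp only [coeff_mk, one_mul]
    have := ArithmeticFunction.sigma_le_pow_succ 3 n
    rw [abs_of_nonneg (by positivity)]
    exact_mod_cast this
  have := Conv.one.add (h1.const_mul 240)
  convert this using 1
  ext n
  simp only [E4, coeff_one, map_add, coeff_mk, coeff_C_mul]
  split_ifs with h
  · subst h; simp
  · simp

open UpperHalfPlane ModularForm MatrixGroups Manifold Matrix.SpecialLinearGroup in
lemma MF_E4 : MF 4 E4 := by
  refine ⟨Conv_E4, ?_⟩
  let f := E (k := 4) (by norm_num)
  have hc : ∀ m, (qExpansion 1 f).coeff m = ((coeff m E4 : ℤ) : ℂ) := by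
    intro m
    rw [EisensteinSeries.E_qExpansion_coeff (by norm_num) (by decide)]
    simp only [E4, coeff_mk]
    split_ifs with h
    · simp
    · rw [bernoulli_eq_bernoulli'_of_ne_one (by norm_num), bernoulli'_four]
      push_cast; norm_num
  have h1 : ∀ τ : ℍ, f τ = ev E4 τ := by
    intro τ
    have h2 := ModularForm.hasSum_qExpansion f (h := 1) one_pos (by simp) τ
    have h3 := ev_hasSum_qParam Conv_E4 τ
    simp only [hc] at h2
    exact h2.unique (by simpa using h3)
  intro z hz
  let τ : ℍ := ⟨z, hz⟩
  have hS : (ModularGroup.S : GL (Fin 2) ℝ) ∈ 𝒮ℒ := ⟨ModularGroup.S, rfl⟩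
  have h4 : f (ModularGroup.S • τ) = (denom (ModularGroup.S : GL (Fin 2) ℝ) τ) ^ (4 : ℤ) * f τ :=
    SlashInvariantForm.slash_action_eqn'' f hS τ
  rw [h1, h1, UpperHalfPlane.modular_S_smul, ModularGroup.denom_S] at h4
  have e : -1 / z = (-z)⁻¹ := by rw [inv_neg]; ring
  rw [e]
  exact_mod_cast h4

end MPC


namespace MPC
open PowerSeries Complex

lemma MF.div {s t : ℕ} {A B : ℤ⟦X⟧} (hA : MF s A) (h0 : ∀ z : ℂ, 0 < z.im → ev A z ≠ 0) (hB : Conv B)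
    (h : MF (s + t) (A * B)) : MF t B := by
  refine ⟨hB, fun z hz => ?_⟩
  have h1 := h.2 z hz
  rw [ev_mul hA.1 hB hz, ev_mul hA.1 hB (im_neg_inv hz), hA.2 z hz, pow_add] at h1
  have hz0 : z ≠ 0 := by rintro rfl; simp at hz
  have h2 := h0 z hz
  have h3 : z ^ s * ev A z ≠ 0 := mul_ne_zero (pow_ne_zero _ hz0) h2
  apply mul_left_cancel₀ h3
  rw [h1]; ring

lemma ev_Dl_ne_zero {z : ℂ} (hz : 0 < z.im) : ev Dl z ≠ 0 := by
  rw [ev_Dl hz]; exact pow_ne_zero _ (eta_ne_zero' hz)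

lemma Eu_pow_mul_Pg_pow (n : ℕ) : Eu ^ n * Pg ^ n = 1 := by rw [← mul_pow, Eu_mul_Pg, one_pow]

lemma constCoeff_E4 : constantCoeff E4 = 1 := by
  rw [← coeff_zero_eq_constantCoeff_apply]; simp [E4]

lemma MF.struct {σ : ℕ} {P : ℤ⟦X⟧} (hP : MF (12 * (σ + 1)) P) :
    ∃ P', MF (12 * σ) P' ∧ P = C (constantCoeff P) * E4 ^ (3 * (σ + 1)) + Dl * P' := by
  have hE : MF (12 * (σ + 1)) (E4 ^ (3 * (σ + 1))) := by
    have := MF_E4.pow (3 * (σ + 1)); rwa [← mul_assoc] at this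
  have hQ := hP.sub (hE.const_mul (constantCoeff P))
  set Q := P - C (constantCoeff P) * E4 ^ (3 * (σ + 1)) with hQd
  have hQ0 : constantCoeff Q = 0 := by simp [hQd, constCoeff_E4]
  have hQX : Q = X * MPC.sub 1 1 Q := by
    ext n
    cases n with
    | zero => simpa using hQ0
    | succ n => rw [coeff_succ_X_mul]; simp [MPC.sub, add_comm]
  have hD : Dl * (MPC.sub 1 1 Q * Pg ^ 24) = Q := by
    conv_rhs => rw [hQX]
    rw [Dl]
    linear_combination (X * MPC.sub 1 1 Q) * Eu_pow_mul_Pg_pow 24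
  refine ⟨MPC.sub 1 1 Q * Pg ^ 24, ?_, ?_⟩
  · refine MF_Dl.div (fun z hz => ev_Dl_ne_zero hz) ((hQ.1.sub 1 1 one_pos).mul (Conv_Pg.pow _)) ?_
    rw [hD]; convert hQ using 1; ring
  · rw [hD]; ring

/-- reduction mod M -/
noncomputable abbrev red (M : ℕ) : ℤ⟦X⟧ →+* (ZMod M)⟦X⟧ := PowerSeries.map (Int.castRingHom (ZMod M))

lemma MF_finite (M : ℕ) [NeZero M] (σ : ℕ) : {f | ∃ P, MF (12 * σ) P ∧ f = red M P}.Finite := by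
  induction σ with
  | zero =>
    refine (Set.finite_range (fun a : ZMod M => (C a : (ZMod M)⟦X⟧))).subset ?_
    rintro f ⟨P, hP, rfl⟩
    rw [mul_zero] at hP
    rw [hP.zero_const]
    exact ⟨_, (PowerSeries.map_C _ _).symm⟩
  | succ σ ih =>
    refine (Set.Finite.image2 (fun (a : ZMod M) (g : (ZMod M)⟦X⟧) => C a * red M E4 ^ (3 * (σ + 1)) + red M Dl * g)
      (Set.finite_univ) ih).subset ?_
    rintro f ⟨P, hP, rfl⟩
    obtain ⟨P', hP', h⟩ := hP.struct
    refine ⟨((constantCoeff P : ℤ) : ZMod M), Set.mem_univ _, red M P', ⟨P', hP', rfl⟩, ?_⟩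
    conv_rhs => rw [h]
    rw [map_add, map_mul, map_mul, map_pow, PowerSeries.map_C]; simp

lemma MF_divide (M : ℕ) (j : ℕ) : ∀ (σ : ℕ) (P : ℤ⟦X⟧), j ≤ σ → MF (12 * σ) P → X ^ j ∣ red M P →
    ∃ P', MF (12 * (σ - j)) P' ∧ red M P = red M (Dl ^ j * P') := by
  induction j with
  | zero => intro σ P _ hP _; exact ⟨P, by simpa using hP, by simp⟩
  | succ j ih =>
    intro σ P hj hP hX
    obtain ⟨σ, rfl⟩ : ∃ σ', σ = σ' + 1 := ⟨σ - 1, by omega⟩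
    obtain ⟨P', hP', h⟩ := hP.struct
    have h0 : ((constantCoeff P : ℤ) : ZMod M) = 0 := by
      have := X_pow_dvd_iff.1 hX 0 (by omega)
      simpa using this
    have h1 : red M P = red M (Dl * P') := by
      conv_lhs => rw [h]
      rw [map_add, map_mul, PowerSeries.map_C]
      simp [h0]
    have h2 : X ^ j ∣ red M P' := by
      rw [h1, Dl, mul_assoc, map_mul, PowerSeries.map_X] at hX
      have h3 : X ^ j ∣ red M (Eu ^ 24 * P') := by
        rw [X_pow_dvd_iff] at hX ⊢
        intro n hn
        have := hX (n + 1) (by omega)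
        rwa [coeff_succ_X_mul] at this
      have h4 := h3.mul_left (red M (Pg ^ 24))
      rw [← map_mul] at h4
      rwa [show Pg ^ 24 * (Eu ^ 24 * P') = P' by linear_combination P' * Eu_pow_mul_Pg_pow 24] at h4
    obtain ⟨P'', h5, h6⟩ := ih σ P' (by omega) hP' h2
    refine ⟨P'', by convert h5 using 2; omega, ?_⟩
    rw [h1, map_mul, h6, ← map_mul]; congr 1; ring

end MPC


namespace MPC
open PowerSeries Complex

lemma avg {P : ℤ⟦X⟧} (hP : Conv P) (L : ℕ) (hL : 0 < L) (a : ℤ) (ha : IsCoprime (L : ℤ) a) (d : ℕ) (hd : d < L)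
    {z : ℂ} (hz : 0 < z.im) :
    ∑ b ∈ Finset.range L, qe (-(d * ((z + a * b) / L))) * ev P ((z + a * b) / L) = L * ev (MPC.sub L d P) z := by
  have hL0 : (L : ℂ) ≠ 0 := by exact_mod_cast hL.ne'
  have him : ∀ b : ℕ, 0 < ((z + a * b) / L).im := by
    intro b
    rw [Complex.div_natCast_im]
    apply div_pos _ (by exact_mod_cast hL)
    simpa using hz
  have h1 : HasSum (fun n => ∑ b ∈ Finset.range L, qe (-(d * ((z + a * b) / L))) *
      (((coeff n P : ℤ) : ℂ) * qe ((z + a * b) / L) ^ n))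
      (∑ b ∈ Finset.range L, qe (-(d * ((z + a * b) / L))) * ev P ((z + a * b) / L)) :=
    hasSum_sum fun b _ => (hP.hasSum (him b)).mul_left _
  have h2 : ∀ n, ∑ b ∈ Finset.range L, qe (-(d * ((z + a * b) / L))) *
      (((coeff n P : ℤ) : ℂ) * qe ((z + a * b) / L) ^ n) =
      ((coeff n P : ℤ) : ℂ) * qe ((n - d) * z / L) * if (L : ℤ) ∣ (n - d : ℤ) then (L : ℂ) else 0 := by
    intro n
    have h3 := sum_range_qe L hL (a * (n - d))
    have h4 : (L : ℤ) ∣ a * (n - d) ↔ (L : ℤ) ∣ (n - d : ℤ) :=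
      ⟨fun h => ha.dvd_of_dvd_mul_left h, fun h => h.mul_left _⟩
    simp only [h4] at h3
    rw [← h3, Finset.mul_sum]
    refine Finset.sum_congr rfl fun b _ => ?_
    rw [← qe_nat_mul, mul_left_comm, ← qe_add, mul_assoc, ← qe_add]
    congr 2
    push_cast
    field_simp
    ring
  simp only [h2] at h1
  have hinj : Function.Injective (fun n : ℕ => L * n + d) := fun a b h => by simpa [hL.ne'] using h
  rw [← hinj.hasSum_iff] at h1
  · refine h1.unique ?_
    have h5 := ((hP.sub L d hL).hasSum hz).mul_left (L : ℂ)
    refine h5.congr_fun fun n => ?_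
    simp only [Function.comp, MPC.sub, coeff_mk]
    rw [if_pos (by push_cast; simp), ← qe_nat_mul]
    have : ((L * n + d : ℕ) - d : ℂ) * z / L = n * z := by push_cast; field_simp; ring
    rw [this]; ring
  · intro n hn
    rw [if_neg, mul_zero]
    rintro ⟨e, he⟩
    apply hn
    have he0 : 0 ≤ e := by
      by_contra hneg
      have : (L : ℤ) * e ≤ L * (-1) := by
        apply mul_le_mul_of_nonneg_left (by omega) (by positivity)
      omega
    refine ⟨e.toNat, ?_⟩
    simp only
    zify
    rw [Int.toNat_of_nonneg he0]; omega

lemma sum_unit (c : ℕ) [NeZero c] (f : ℤ → ℂ) (hf : ∀ a b, (c : ℤ) ∣ a - b → f a = f b) :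
    ∑ b ∈ Finset.range c, f b = ∑ u : (ZMod c)ˣ, f ((u : ZMod c).val) +
      ∑ b ∈ (Finset.range c).filter (fun b => ¬ Nat.Coprime b c), f b := by
  rw [← Finset.sum_filter_add_sum_filter_not (Finset.range c) (fun b => Nat.Coprime b c)]
  congr 1
  refine Finset.sum_bij' (fun b hb => ZMod.unitOfCoprime b (Finset.mem_filter.1 hb).2)
    (fun u _ => (u : ZMod c).val) ?_ ?_ ?_ ?_ ?_
  · simp
  · intro u _
    simpa [ZMod.val_lt] using ZMod.val_coe_unit_coprime u
  · intro b hb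
    simp only [ZMod.coe_unitOfCoprime]
    exact ZMod.val_cast_of_lt (by simpa using (Finset.mem_filter.1 hb).1)
  · intro u _
    ext; simp
  · intro b hb
    simp only [ZMod.coe_unitOfCoprime]
    rw [ZMod.val_cast_of_lt (by simpa using (Finset.mem_filter.1 hb).1)]

lemma sum_unit_perm (c : ℕ) [NeZero c] (f g : ℤ → ℂ) (hg : ∀ a b, (c : ℤ) ∣ a - b → g a = g b) (D : ℕ)
    (hD : D.Coprime c) (K : ℂ) (h : ∀ x y : ℤ, (c : ℤ) ∣ D * x * y - 1 → f x = K * g (-y)) :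
    ∑ u : (ZMod c)ˣ, f ((u : ZMod c).val) = K * ∑ u : (ZMod c)ˣ, g ((u : ZMod c).val) := by
  let v := ZMod.unitOfCoprime D hD
  let e : (ZMod c)ˣ ≃ (ZMod c)ˣ := (Equiv.mulLeft v).trans ((Equiv.inv _).trans (Equiv.neg _))
  rw [← Equiv.sum_comp e (fun u => g ((u : ZMod c).val)), Finset.mul_sum]
  refine Finset.sum_congr rfl fun u _ => ?_
  have he : e u = -(v * u)⁻¹ := rfl
  rw [h _ ((((v * u)⁻¹ : (ZMod c)ˣ) : ZMod c).val)]
  · congr 1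
    apply hg
    rw [← ZMod.intCast_zmod_eq_zero_iff_dvd, he]
    simp
  · rw [← ZMod.intCast_zmod_eq_zero_iff_dvd]
    push_cast
    simp only [ZMod.natCast_val, ZMod.cast_id', id]
    have : (D : ZMod c) = v := rfl
    rw [this, ← Units.val_mul, ← Units.val_mul, mul_inv_cancel]; simp

end MPC


namespace MPC
open PowerSeries Complex

lemma ev_periodic (P : ℤ⟦X⟧) (c : ℕ) (hc : 0 < c) (z : ℂ) (a b : ℤ) (h : (c : ℤ) ∣ a - b) :
    ev P ((z + a) / c) = ev P ((z + b) / c) := by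
  obtain ⟨d, hd⟩ := h
  have hc0 : (c : ℂ) ≠ 0 := by exact_mod_cast hc.ne'
  rw [← ev_add_int P ((z + b) / c) d]
  congr 1
  have : (a : ℂ) - b = c * d := by exact_mod_cast hd
  field_simp
  linear_combination this

/-- Hecke operator at a prime -/
noncomputable def Tm (m w : ℕ) (hm : m ≠ 0) (P : ℤ⟦X⟧) : ℤ⟦X⟧ :=
  MPC.sub m 0 P + C ((m : ℤ) ^ (w - 1)) * expand m hm P

lemma filter_prime (m : ℕ) (hm : m.Prime) : (Finset.range m).filter (fun b => ¬ Nat.Coprime b m) = {0} := by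
  ext b
  simp only [Finset.mem_filter, Finset.mem_range, Finset.mem_singleton]
  constructor
  · rintro ⟨h1, h2⟩
    by_contra h0
    exact h2 ((Nat.coprime_comm.1 (hm.coprime_iff_not_dvd.2 fun h => absurd (Nat.le_of_dvd (by omega) h) (by omega))))
  · rintro rfl
    exact ⟨hm.pos, by simp [Nat.coprime_zero_left, hm.one_lt.ne']⟩

lemma ev_Tm {P : ℤ⟦X⟧} (hP : Conv P) (m w : ℕ) [Fact m.Prime] (hm : m.Prime) (hw : 1 ≤ w) {z : ℂ} (hz : 0 < z.im) :
    m * ev (Tm m w hm.ne_zero P) z = ∑ u : (ZMod m)ˣ, ev P ((z + ((u : ZMod m).val : ℤ)) / m) + ev P (z / m)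
      + m ^ w * ev P (m * z) := by
  have h1 := avg hP m hm.pos 1 isCoprime_one_right 0 hm.pos hz
  have h2 := sum_unit m (fun b => ev P ((z + b) / m)) (fun a b h => ev_periodic P m hm.pos z a b h)
  rw [filter_prime m hm] at h2
  simp only [Finset.sum_singleton, Int.cast_natCast, Nat.cast_zero, Int.cast_zero, add_zero, zero_mul, neg_zero, qe_zero, one_mul, Int.cast_one] at h1 h2
  rw [Tm, ev_add (hP.sub _ _ hm.pos) ((hP.expand _ _).const_mul _) hz, ev_C_mul, ev_expand, mul_add, ← h1, h2]
  obtain ⟨w, rfl⟩ : ∃ v, w = v + 1 := ⟨w - 1, by omega⟩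
  simp only [Int.cast_natCast, add_tsub_cancel_right]
  push_cast
  ring

lemma MF.Tm {w : ℕ} {P : ℤ⟦X⟧} (hP : MF w P) (m : ℕ) (hm : m.Prime) (hw : 1 ≤ w) : MF w (Tm m w hm.ne_zero P) := by
  haveI : Fact m.Prime := ⟨hm⟩
  refine ⟨(hP.1.sub _ _ hm.pos).add ((hP.1.expand _ _).const_mul _), fun z hz => ?_⟩
  have hm0 : (m : ℂ) ≠ 0 := by exact_mod_cast hm.ne_zero
  have hz0 : z ≠ 0 := by rintro rfl; simp at hz
  have hmp : (0 : ℝ) < m := by exact_mod_cast hm.pos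
  apply mul_left_cancel₀ hm0
  rw [ev_Tm hP.1 m w hm hw (im_neg_inv hz), mul_left_comm, ev_Tm hP.1 m w hm hw hz]
  have h1 := sum_unit_perm m (fun b => ev P ((-1 / z + b) / m)) (fun b => ev P ((z + b) / m))
    (fun a b h => ev_periodic P m hm.pos z a b h) 1 (Nat.coprime_one_left _) (z ^ w) (fun x y hxy => by
      have := hP.trans m hm.pos x y (by simpa using hxy) hz
      rw [show (-1 / z + x) = x - 1 / z by ring, this]
      push_cast; rfl)
  have h2 : ev P (-1 / z / m) = z ^ w * (m ^ w * ev P (m * z)) := by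
    have := hP.2 (m * z) (by simpa using mul_pos hmp hz)
    rw [show -1 / z / m = -1 / (m * z) by field_simp, this]; ring
  have h3 : ev P (m * (-1 / z)) = z ^ w / m ^ w * ev P (z / m) := by
    have := hP.2 (z / m) (by rw [Complex.div_natCast_im]; exact div_pos hz hmp)
    rw [show m * (-1 / z) = -1 / (z / m) by field_simp, this]; rw [div_pow]
  rw [h1, h2, h3]
  field_simp
  ring

end MPC


namespace MPC
open PowerSeries Complex

lemma red_eq_iff (M : ℕ) (P Q : ℤ⟦X⟧) :
    red M P = red M Q ↔ ∀ n, ((coeff n P : ℤ) : ZMod M) = ((coeff n Q : ℤ) : ZMod M) := by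
  rw [PowerSeries.ext_iff]; simp

lemma red_of_dvd (M : ℕ) (P Q : ℤ⟦X⟧) (h : (M : ℤ⟦X⟧) ∣ P - Q) : red M P = red M Q := by
  obtain ⟨R, hR⟩ := h
  rw [← sub_eq_zero, ← map_sub, hR, map_mul, map_natCast]
  have : ((M : ℕ) : (ZMod M)⟦X⟧) = 0 := by
    rw [← map_natCast (C (R := ZMod M)), ZMod.natCast_self, map_zero]
  rw [this, zero_mul]

lemma dvd_of_red (M : ℕ) (P Q : ℤ⟦X⟧) (h : red M P = red M Q) : (M : ℤ⟦X⟧) ∣ P - Q := by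
  rw [red_eq_iff] at h
  have : ∀ n, ∃ r : ℤ, coeff n P - coeff n Q = M * r := fun n => by
    have := h n
    rw [← sub_eq_zero, ← Int.cast_sub, ZMod.intCast_zmod_eq_zero_iff_dvd] at this
    exact this
  choose r hr using this
  refine ⟨PowerSeries.mk r, ?_⟩
  ext n
  rw [← map_natCast (C (R := ℤ)), coeff_C_mul, map_sub, hr, coeff_mk]

lemma frob_one (m : ℕ) [hm : Fact m.Prime] (f : (ZMod m)⟦X⟧) : expand m hm.1.ne_zero f = f ^ m := by
  have h := MvPowerSeries.map_frobenius_expand (σ := Unit) (R := ZMod m) m hm.1.ne_zero (f := f)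
  rw [ZMod.frobenius_zmod, MvPowerSeries.map_id] at h
  exact h

lemma frob_pow (m : ℕ) [hm : Fact m.Prime] (f : (ZMod m)⟦X⟧) (k : ℕ) :
    expand (m ^ k) (pow_ne_zero k hm.1.ne_zero) f = f ^ m ^ k := by
  induction k generalizing f with
  | zero => simp
  | succ k ih =>
    have := PowerSeries.expand_mul (m ^ k) (pow_ne_zero k hm.1.ne_zero) m hm.1.ne_zero f
    simp only [pow_succ]
    rw [this, frob_one, map_pow, ih, pow_mul]

lemma frob_red (m : ℕ) [hm : Fact m.Prime] (A : ℤ⟦X⟧) (k : ℕ) :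
    red (m ^ k) (A ^ (m ^ k * m ^ k)) = red (m ^ k) (expand (m ^ k) (pow_ne_zero k hm.1.ne_zero) A ^ m ^ k) := by
  have h1 : red m (A ^ m ^ k) = red m (expand (m ^ k) (pow_ne_zero k hm.1.ne_zero) A) := by
    rw [map_pow, ← frob_pow, PowerSeries.map_expand]
  have h2 := dvd_sub_pow_of_dvd_sub (dvd_of_red _ _ _ h1) k
  rw [← pow_mul] at h2
  apply red_of_dvd
  refine dvd_trans ?_ h2
  rw [pow_succ]; push_cast; exact dvd_mul_right _ _

lemma sub_sub' (a b : ℕ) (P : ℤ⟦X⟧) : MPC.sub a 0 (MPC.sub b 0 P) = MPC.sub (b * a) 0 P := by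
  ext n; simp [MPC.sub, mul_assoc]

lemma red_sub (M a d : ℕ) (P Q : ℤ⟦X⟧) (h : red M P = red M Q) : red M (MPC.sub a d P) = red M (MPC.sub a d Q) := by
  rw [red_eq_iff] at *
  intro n; simp [MPC.sub, h]

lemma sub_expand_mul (L : ℕ) (hL : L ≠ 0) (A B : ℤ⟦X⟧) : MPC.sub L 0 (A * expand L hL B) = MPC.sub L 0 A * B := by
  ext n
  rw [coeff_mul]
  simp only [MPC.sub, coeff_mk, add_zero]
  rw [coeff_mul]
  symm
  refine Finset.sum_of_injOn (fun p => (L * p.1, L * p.2)) ?_ ?_ ?_ ?_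
  · rintro ⟨a, b⟩ _ ⟨c, d⟩ _ h
    simpa [hL] using h
  · rintro ⟨a, b⟩ h
    simp at h ⊢
    rw [← mul_add, h]
  · rintro ⟨a, b⟩ h hn
    have hab : a + b = L * n := by simpa using h
    rw [coeff_expand_of_not_dvd, mul_zero]
    rintro ⟨b', rfl⟩
    apply hn
    have ha : L ∣ a := (Nat.dvd_add_left (dvd_mul_right _ _)).1 (hab ▸ dvd_mul_right _ _)
    obtain ⟨a', rfl⟩ := ha
    refine ⟨(a', b'), ?_, rfl⟩
    simp
    rw [← mul_add] at hab
    exact Nat.eq_of_mul_eq_mul_left (by omega) hab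
  · rintro ⟨a, b⟩ _
    rw [coeff_expand_mul]

lemma MF_U {w : ℕ} {P : ℤ⟦X⟧} (hP : MF w P) (m k : ℕ) (hm : m.Prime) (hw : k + 1 ≤ w) :
    ∃ Q, MF w Q ∧ red (m ^ k) Q = red (m ^ k) (MPC.sub (m ^ k) 0 P) := by
  suffices ∀ i, ∃ Q, MF w Q ∧ red (m ^ k) Q = red (m ^ k) (MPC.sub (m ^ i) 0 P) from this k
  intro i
  induction i with
  | zero => exact ⟨P, hP, by congr 1; ext n; simp [MPC.sub]⟩
  | succ i ih =>
    obtain ⟨Q, hQ, h⟩ := ih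
    refine ⟨_, hQ.Tm m hm (by omega), ?_⟩
    rw [pow_succ, ← sub_sub', ← red_sub _ _ _ _ _ h, MPC.Tm, map_add, map_mul, PowerSeries.map_C]
    have : (Int.castRingHom (ZMod (m ^ k))) ((m : ℤ) ^ (w - 1)) = 0 := by
      have e : w - 1 = k + (w - 1 - k) := by omega
      rw [e, pow_add]
      have : ((m ^ k : ℕ) : ZMod (m ^ k)) = 0 := ZMod.natCast_self _
      push_cast at this
      simp [this]
    rw [this]; simp

end MPC


namespace MPC
open PowerSeries Complex

lemma X_pow_mul_cancel' {R : Type*} [CommRing R] (j : ℕ) (A B : R⟦X⟧) (h : X ^ j * A = X ^ j * B) : A = B := by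
  ext n
  have := congrArg (coeff (n + j)) h
  simpa [coeff_X_pow_mul] using this

lemma exists_form (m k r : ℕ) (hm : m.Prime) (hm5 : 5 ≤ m) (hk : 0 < k) (hr : 0 < r) (hrodd : Odd r) (hrm : r < m ^ k) :
    ∃ t τ : ℕ, ∃ P : ℤ⟦X⟧, Odd t ∧ t < 24 ∧ 1 ≤ τ ∧ MF (12 * τ) P ∧
      (∀ i, ((multipartition r ((m ^ k * (24 * i + t) + r) / 24) : ℕ) : ZMod (m ^ k)) = coeff i (red (m ^ k) (Eu ^ t * P))) ∧
      ∀ N, 0 < N → 24 ∣ m ^ k * N + r → ∃ i, N = 24 * i + t := by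
  haveI : Fact m.Prime := ⟨hm⟩
  have hkq : k < m ^ k := Nat.lt_pow_self (by omega)
  have hm2 : Nat.Coprime m 24 := by
    rw [show 24 = 2 ^ 3 * 3 by norm_num]
    refine Nat.Coprime.mul_right (Nat.Coprime.pow_right _ ?_) ?_
    · exact (Nat.coprime_primes hm Nat.prime_two).2 (by omega)
    · exact (Nat.coprime_primes hm Nat.prime_three).2 (by omega)
  have hq24 : Nat.Coprime (m ^ k) 24 := hm2.pow_left k
  have hq5 : 5 ≤ m ^ k := hm5.trans (Nat.le_self_pow hk.ne' m)
  have hq0 : m ^ k ≠ 0 := by omega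
  have hfr : ∀ h0 : m ^ k ≠ 0, red (m ^ k) (Eu ^ (m ^ k * m ^ k)) = red (m ^ k) (expand (m ^ k) h0 Eu ^ m ^ k) :=
    fun _ => frob_red m Eu k
  have hU := fun (w : ℕ) (P : ℤ⟦X⟧) (hP : MF w P) (hw : k + 1 ≤ w) => MF_U hP m k hm hw
  generalize hq : m ^ k = q at *
  have hqq : q * q % 24 = 1 := by
    have h1 : q % 24 < 24 := Nat.mod_lt _ (by norm_num)
    have h2 : Nat.gcd (q % 24) 24 = 1 := by rw [← Nat.gcd_rec, Nat.gcd_comm]; exact hq24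
    rw [Nat.mul_mod]
    generalize q % 24 = a at *
    interval_cases a <;> simp_all
  have hqodd : q % 2 = 1 := by
    by_contra h
    have : (q * q) % 2 = 0 := by rw [Nat.mul_mod]; simp [show q % 2 = 0 by omega]
    omega
  obtain ⟨a, ha⟩ : ∃ a, q * q = 24 * a + 1 := ⟨q * q / 24, by omega⟩
  obtain ⟨r', rfl⟩ := hrodd
  obtain ⟨q', hq'⟩ : ∃ q', q = 2 * q' + 1 := ⟨q / 2, by omega⟩
  set r := 2 * r' + 1 with hrr
  obtain ⟨σ, hσ⟩ : ∃ σ, 24 * σ + r = 25 * r * (q * q) := ⟨r * (25 * a + 1), by rw [ha]; ring⟩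
  obtain ⟨j, t, hjt, htodd, ht⟩ : ∃ j t, 24 * j = 25 * r * q + t ∧ t % 2 = 1 ∧ t < 24 := by
    have : (25 * r * q) % 2 = 1 := by
      rw [Nat.mul_mod, Nat.mul_mod 25]; simp [hqodd, show r % 2 = 1 by omega]
    exact ⟨25 * r * q / 24 + 1, 24 * (25 * r * q / 24 + 1) - 25 * r * q, by omega, by omega, by omega⟩
  have hjσ : j + 1 ≤ σ := by
    have : 25 * r * q + r + 48 ≤ 25 * r * (q * q) := by nlinarith
    omega
  have hkσ : k + 1 ≤ 12 * σ := by
    have : q ≤ r * q := Nat.le_mul_of_pos_left _ hr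
    have : 25 * r * q = 25 * (r * q) := by ring
    omega
  have hDσ : MF (12 * σ) (Dl ^ σ) := MF_Dl.pow σ
  obtain ⟨Q, hQ, hQ2⟩ := hU _ _ hDσ hkσ
  set V := MPC.sub q 0 (X ^ σ * Pg ^ r) with hV
  have h1 : red q (Dl ^ σ) = red q (X ^ σ * Pg ^ r * expand q hq0 (Eu ^ (25 * r * q))) := by
    have e1 : Dl ^ σ = X ^ σ * Pg ^ r * (Eu ^ (q * q)) ^ (25 * r) := by
      rw [← pow_mul, show q * q * (25 * r) = 24 * σ + r by rw [hσ]; ring, Dl, mul_pow, ← pow_mul, pow_add]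
      linear_combination -(X ^ σ * Eu ^ (24 * σ)) * Eu_pow_mul_Pg_pow r
    rw [e1, map_mul, map_pow, hfr hq0, ← map_pow, ← map_mul, ← pow_mul, map_pow (expand q hq0)]
    congr 3; ring
  have h2 : red q Q = red q (V * Eu ^ (25 * r * q)) := by
    rw [hQ2, red_sub _ _ _ _ _ h1, sub_expand_mul]
  set F := MPC.sub 1 j V with hF
  have hV0 : ∀ n, n < j → coeff n V = 0 := by
    intro n hn
    simp only [hV, MPC.sub, coeff_mk, add_zero]
    rw [coeff_X_pow_mul', if_neg]
    have e1 : (25 * r * q) % 2 = 1 := by omega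
    have e2 : 24 * n + 1 ≤ 25 * r * q := by omega
    have e3 : (24 * n + 1) * q ≤ 25 * r * q * q := Nat.mul_le_mul_right _ e2
    nlinarith
  have hVF : V = X ^ j * F := by
    ext n
    rw [coeff_X_pow_mul']
    split_ifs with h
    · simp only [hF, MPC.sub, coeff_mk]; congr 1; congr 1; omega
    · exact hV0 n (by omega)
  obtain ⟨P', hP', h3⟩ := MF_divide q j σ Q (by omega) hQ (by
    rw [h2, hVF, map_mul, map_mul, map_pow, PowerSeries.map_X, mul_assoc]; exact dvd_mul_right _ _)
  have h4 : red q F = red q (Eu ^ t * P') := by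
    have : red q (F * Eu ^ (25 * r * q)) = red q (Eu ^ (24 * j) * P') := by
      apply X_pow_mul_cancel' j
      have e : red q (X ^ j) = X ^ j := by rw [map_pow, PowerSeries.map_X]
      rw [← e, ← map_mul, ← map_mul, ← mul_assoc, ← hVF, ← h2, h3, Dl, mul_pow, ← pow_mul, mul_assoc]
    have h5 := congrArg (fun A => red q (Pg ^ (25 * r * q)) * A) this
    simp only [← map_mul] at h5
    rw [hjt, pow_add] at h5
    rw [show F = Pg ^ (25 * r * q) * (F * Eu ^ (25 * r * q)) by
      linear_combination -F * Eu_pow_mul_Pg_pow (25 * r * q), h5]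
    congr 1
    linear_combination Eu ^ t * P' * Eu_pow_mul_Pg_pow (25 * r * q)
  have h24 : 24 * (q * j) = 24 * σ + r + q * t := by rw [hσ]; linear_combination q * hjt
  refine ⟨t, σ - j, P', Nat.odd_iff.2 htodd, ht, by omega, hP', ?_, ?_⟩
  · intro i
    rw [← h4, coeff_map]
    have e0 : q * (24 * i + t) = 24 * (q * i) + q * t := by ring
    have e1 : (q * (24 * i + t) + r) / 24 = q * i + q * j - σ := by omega
    rw [e1]
    have e2 : coeff i F = (multipartition r (q * i + q * j - σ) : ℤ) := by
      rw [multipartition_eq]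
      simp only [hF, hV, MPC.sub, coeff_mk, one_mul, add_zero, mul_add]
      rw [coeff_X_pow_mul', if_pos (by omega)]
    rw [e2]; simp
  · intro N hN hd
    have e1 : 24 ∣ q * t + r := by omega
    have e2 : q * N ≡ q * t [MOD 24] := by
      apply Nat.ModEq.add_right_cancel' r
      exact ((Nat.modEq_zero_iff_dvd.2 hd)).trans (Nat.modEq_zero_iff_dvd.2 e1).symm
    have e3 := Nat.ModEq.cancel_left_of_coprime (by rwa [Nat.gcd_comm]) e2
    refine ⟨N / 24, ?_⟩
    have : N % 24 = t % 24 := e3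
    omega

end MPC


namespace MPC
open PowerSeries Complex

/-- half-integral weight form -/
noncomputable def gf (P : ℤ⟦X⟧) (t : ℕ) (z : ℂ) : ℂ := eta z ^ t * ev P z

lemma eta_add24 (z : ℂ) (n : ℤ) : eta (z + 24 * n) = eta z := by
  rw [eta, eta]
  have h1 := ev_add_int Eu z (24 * n)
  push_cast at h1
  rw [h1]
  congr 1
  apply qe_eq_of_sub _ _ n
  ring

lemma gf_add24 (P : ℤ⟦X⟧) (t : ℕ) (z : ℂ) (n : ℤ) : gf P t (z + 24 * n) = gf P t z := by
  rw [gf, gf, eta_add24]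
  have h1 := ev_add_int P z (24 * n)
  push_cast at h1
  rw [h1]

lemma gf_per (P : ℤ⟦X⟧) (t : ℕ) (c : ℕ) (hc : 0 < c) (z : ℂ) (a b : ℤ) (h : (c : ℤ) ∣ a - b) :
    gf P t ((z + 24 * a) / c) = gf P t ((z + 24 * b) / c) := by
  obtain ⟨d, hd⟩ := h
  have hc0 : (c : ℂ) ≠ 0 := by exact_mod_cast hc.ne'
  rw [← gf_add24 P t ((z + 24 * b) / c) d]
  congr 1
  have : (a : ℂ) - b = c * d := by exact_mod_cast hd
  field_simp
  linear_combination 24 * this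

/-- automorphy factor -/
noncomputable def J (t s : ℕ) (w : ℂ) : ℂ := rt w ^ t * w ^ s

lemma gf_inv {s : ℕ} {P : ℤ⟦X⟧} (hP : MF s P) (t : ℕ) {w : ℂ} (hw : 0 < w.im) :
    gf P t (-1 / w) = J t s w * gf P t w := by
  rw [gf, gf, J, key1 hw, hP.2 w hw]; ring

lemma J_inv {s : ℕ} (hs : Even s) (t : ℕ) {w : ℂ} (hw : 0 < w.im) : J t s (-1 / w) * J t s w = 1 := by
  have hw0 : w ≠ 0 := by rintro rfl; simp at hw
  have h1 := key1 hw
  have h2 := key1 (im_neg_inv hw)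
  rw [show -1 / (-1 / w) = w by field_simp, h1, ← mul_assoc] at h2
  have h3 : rt (-1 / w) * rt w = 1 := by
    apply mul_right_cancel₀ (eta_ne_zero' hw)
    rw [one_mul]; exact h2.symm
  have h4 : (-1 / w) ^ s * w ^ s = 1 := by
    rw [← mul_pow, show -1 / w * w = -1 by field_simp, hs.neg_one_pow]
  rw [J, J]
  calc _ = (rt (-1 / w) * rt w) ^ t * ((-1 / w) ^ s * w ^ s) := by ring
    _ = 1 := by rw [h3, h4]; simp

section
variable (l : ℕ) [hlF : Fact l.Prime]

/-- middle summand -/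
noncomputable def hm (P : ℤ⟦X⟧) (t s : ℕ) (z : ℂ) (b : ℤ) : ℂ :=
  l ^ s * (kap l * chi l (-b : ℤ) * gau l) ^ t * gf P t (z + 24 * b / l)

lemma hm_per (P : ℤ⟦X⟧) (t s : ℕ) (z : ℂ) (a b : ℤ) (h : (l : ℤ) ∣ a - b) : hm l P t s z a = hm l P t s z b := by
  have h1 : ((-a : ℤ) : ZMod l) = ((-b : ℤ) : ZMod l) := by
    have := (ZMod.intCast_zmod_eq_zero_iff_dvd (a - b) l).2 h
    push_cast at this ⊢
    rw [sub_eq_zero] at this; rw [this]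
  rw [hm, hm, h1]
  congr 1
  have hl0 : (l : ℂ) ≠ 0 := by exact_mod_cast hlF.1.ne_zero
  have := gf_per P t l hlF.1.pos (l * z) a b h
  rwa [add_div, add_div, mul_div_cancel_left₀ _ hl0] at this

lemma coprime576 (h2 : l ≠ 2) (h3 : l ≠ 3) : Nat.Coprime 576 l := by
  rw [show 576 = 2 ^ 6 * 3 ^ 2 by norm_num]
  exact Nat.Coprime.mul_left (Nat.Coprime.pow_left _ ((Nat.coprime_primes Nat.prime_two hlF.1).2 h2.symm))
    (Nat.Coprime.pow_left _ ((Nat.coprime_primes Nat.prime_three hlF.1).2 h3.symm))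

lemma unitsA {s : ℕ} {P : ℤ⟦X⟧} (hP : MF s P) (h2 : l ≠ 2) (h3 : l ≠ 3) (t : ℕ) {w : ℂ} (hw : 0 < w.im) [NeZero (l ^ 2)] :
    ∑ u : (ZMod (l ^ 2))ˣ, gf P t ((-1 / w + 24 * (((u : ZMod (l ^ 2)).val : ℕ) : ℤ)) / (l ^ 2 : ℕ)) =
    J t s w * ∑ u : (ZMod (l ^ 2))ˣ, gf P t ((w + 24 * (((u : ZMod (l ^ 2)).val : ℕ) : ℤ)) / (l ^ 2 : ℕ)) := by
  have hl := hlF.1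
  have hl2 : 0 < l ^ 2 := pow_pos hl.pos 2
  refine sum_unit_perm (l ^ 2) (fun b => gf P t ((-1 / w + 24 * b) / (l ^ 2 : ℕ))) (fun b => gf P t ((w + 24 * b) / (l ^ 2 : ℕ)))
    (fun a b h => gf_per P t _ hl2 w a b h) 576 ((coprime576 l h2 h3).pow_right 2) _ (fun x y hxy => ?_)
  have hxy' : ((l : ℤ) ^ 2) ∣ 576 * x * y - 1 := by exact_mod_cast hxy
  have e1 := keyl2 l hl h2 h3 x y hxy' hw
  have e2 := hP.trans (l ^ 2) hl2 (24 * x) (24 * y) (by push_cast; convert hxy' using 1; ring) hw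
  push_cast at e2 ⊢
  rw [show -1 / w + 24 * (x : ℂ) = 24 * x - 1 / w by ring, show w + 24 * -(y : ℂ) = w - 24 * y by ring,
    gf, gf, e1, e2, J]
  ring

lemma unitsB {s : ℕ} {P : ℤ⟦X⟧} (hP : MF s P) (h2 : l ≠ 2) (h3 : l ≠ 3) (t : ℕ) {w : ℂ} (hw : 0 < w.im) :
    ∑ u : (ZMod l)ˣ, gf P t ((-1 / w / l + 24 * (((u : ZMod l).val : ℕ) : ℤ)) / l) =
    J t s w * ∑ u : (ZMod l)ˣ, hm l P t s w (((u : ZMod l).val : ℕ) : ℤ) := by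
  have hl := hlF.1
  have hl0 : (l : ℂ) ≠ 0 := by exact_mod_cast hl.ne_zero
  have hlp : (0 : ℝ) < l := by exact_mod_cast hl.pos
  have hw0 : w ≠ 0 := by rintro rfl; simp at hw
  refine sum_unit_perm l (fun b => gf P t ((-1 / w / l + 24 * b) / l)) (fun b => hm l P t s w b)
    (fun a b h => hm_per l P t s w a b h) 576 (coprime576 l h2 h3) _ (fun x y hxy => ?_)
  have hxy' : (576 * x * y : ZMod l) = 1 := by
    have := (ZMod.intCast_zmod_eq_zero_iff_dvd _ l).2 hxy
    push_cast at this
    exact sub_eq_zero.1 this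
  have e1 := keyl l h2 h3 x y hxy' hw
  have hlw : 0 < ((l : ℂ) * w).im := by simpa using mul_pos hlp hw
  have e2 := hP.trans l hl.pos (24 * x) (24 * y) (by convert hxy using 1; push_cast; ring) hlw
  push_cast at e2 ⊢
  rw [show -1 / w / l + 24 * (x : ℂ) = 24 * x - 1 / (l * w) by field_simp; ring, hm, gf, gf, e1, e2, J, neg_neg,
    show ((l : ℂ) * w - 24 * y) / l = w - 24 * y / l by field_simp,
    show w + 24 * ((-y : ℤ) : ℂ) / l = w - 24 * y / l by push_cast; ring]
  ring

lemma filter_sq (f : ℤ → ℂ) : ∑ b ∈ (Finset.range (l ^ 2)).filter (fun b => ¬ Nat.Coprime b (l ^ 2)), f b =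
    ∑ b ∈ Finset.range l, f (l * b) := by
  have hl := hlF.1
  symm
  refine Finset.sum_bij' (fun b _ => l * b) (fun b _ => b / l) ?_ ?_ ?_ ?_ ?_
  · intro b hb
    simp only [Finset.mem_range] at hb
    simp only [Finset.mem_filter, Finset.mem_range]
    refine ⟨by rw [pow_two]; exact Nat.mul_lt_mul_of_pos_left hb hl.pos, fun h => ?_⟩
    have h1 : Nat.Coprime (l * b) l := (Nat.coprime_pow_right_iff (by norm_num) _ _).1 h
    have h2 := Nat.Coprime.eq_one_of_dvd h1.symm (dvd_mul_right _ _)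
    exact hl.one_lt.ne' h2
  · intro b hb
    simp only [Finset.mem_filter, Finset.mem_range] at hb ⊢
    rw [Nat.div_lt_iff_lt_mul hl.pos, ← pow_two]; exact hb.1
  · intro b _
    exact Nat.mul_div_cancel_left _ hl.pos
  · intro b hb
    simp only [Finset.mem_filter, Finset.mem_range] at hb
    refine Nat.mul_div_cancel' ?_
    by_contra h
    exact hb.2 (Nat.Coprime.pow_right _ ((hl.coprime_iff_not_dvd.2 h).symm))
  · intro b _
    push_cast; rfl

lemma sum_decomp (P : ℤ⟦X⟧) (t : ℕ) (z : ℂ) [NeZero (l ^ 2)] :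
    ∑ b ∈ Finset.range (l ^ 2), gf P t ((z + 24 * b) / (l ^ 2 : ℕ)) =
    ∑ u : (ZMod (l ^ 2))ˣ, gf P t ((z + 24 * (((u : ZMod (l ^ 2)).val : ℕ) : ℤ)) / (l ^ 2 : ℕ)) +
    ∑ u : (ZMod l)ˣ, gf P t ((z / l + 24 * (((u : ZMod l).val : ℕ) : ℤ)) / l) + gf P t (z / l ^ 2) := by
  have hl := hlF.1
  have hl0 : (l : ℂ) ≠ 0 := by exact_mod_cast hl.ne_zero
  have h1 := sum_unit (l ^ 2) (fun b => gf P t ((z + 24 * b) / (l ^ 2 : ℕ)))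
    (fun a b h => gf_per P t _ (pow_pos hl.pos 2) z a b h)
  have h2 := sum_unit l (fun b => gf P t ((z / l + 24 * b) / l)) (fun a b h => gf_per P t _ hl.pos (z / l) a b h)
  rw [filter_prime l hl, Finset.sum_singleton] at h2
  rw [filter_sq l (fun b => gf P t ((z + 24 * b) / (l ^ 2 : ℕ)))] at h1
  simp only [Int.cast_natCast] at h1 h2 ⊢
  rw [h1, add_assoc]
  congr 1
  convert h2 using 2
  · rename_i b _
    congr 1; push_cast; field_simp
  · congr 1; push_cast; field_simp; ring

/-- the Hecke sum -/
noncomputable def HS (P : ℤ⟦X⟧) (t s : ℕ) (z : ℂ) : ℂ :=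
  ∑ b ∈ Finset.range (l ^ 2), gf P t ((z + 24 * b) / (l ^ 2 : ℕ)) +
    ∑ u : (ZMod l)ˣ, hm l P t s z (((u : ZMod l).val : ℕ) : ℤ) + l ^ (2 * s + t) * gf P t (l ^ 2 * z)

lemma HS_inv {s : ℕ} (hs : Even s) {P : ℤ⟦X⟧} (hP : MF s P) (h2 : l ≠ 2) (h3 : l ≠ 3) (t : ℕ) {w : ℂ} (hw : 0 < w.im) :
    HS l P t s (-1 / w) = J t s w * HS l P t s w := by
  haveI : NeZero (l ^ 2) := ⟨pow_ne_zero _ hlF.1.ne_zero⟩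
  have hl := hlF.1
  have hl0 : (l : ℂ) ≠ 0 := by exact_mod_cast hl.ne_zero
  have hlp : (0 : ℝ) < l := by exact_mod_cast hl.pos
  have hw0 : w ≠ 0 := by rintro rfl; simp at hw
  have hA := unitsA l hP h2 h3 t hw
  have hB := unitsB l hP h2 h3 t hw
  have hB' := unitsB l hP h2 h3 t (im_neg_inv hw)
  rw [show -1 / (-1 / w) = w by field_simp] at hB'
  have hJ := J_inv hs t hw
  have hB2 : ∑ u : (ZMod l)ˣ, hm l P t s (-1 / w) (((u : ZMod l).val : ℕ) : ℤ) =
      J t s w * ∑ u : (ZMod l)ˣ, gf P t ((w / l + 24 * (((u : ZMod l).val : ℕ) : ℤ)) / l) := by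
    rw [hB']; linear_combination -(∑ u : (ZMod l)ˣ, hm l P t s (-1 / w) (((u : ZMod l).val : ℕ) : ℤ)) * hJ
  have hrt : ∀ v : ℂ, v ≠ 0 → rt (l ^ 2 * v) = l * rt v := by
    intro v hv
    have := rt_mul ((l : ℝ) ^ 2) (by positivity) v hv
    rw [Real.sqrt_sq hlp.le] at this
    exact_mod_cast this
  have hlsq : ∀ v : ℂ, 0 < v.im → 0 < ((l : ℂ) ^ 2 * v).im := by
    intro v hv
    have : (l : ℂ) ^ 2 * v = ((l ^ 2 : ℝ) : ℂ) * v := by push_cast; rfl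
    rw [this, Complex.im_ofReal_mul]; positivity
  have hC : gf P t (-1 / w / l ^ 2) = J t s w * (l ^ (2 * s + t) * gf P t (l ^ 2 * w)) := by
    have := gf_inv hP t (hlsq w hw)
    rw [show -1 / w / (l : ℂ) ^ 2 = -1 / (l ^ 2 * w) by field_simp, this, J, J, hrt w hw0]; ring
  have hD : l ^ (2 * s + t) * gf P t (l ^ 2 * (-1 / w)) = J t s w * gf P t (w / l ^ 2) := by
    have hv0 : w / (l : ℂ) ^ 2 ≠ 0 := by positivity
    have hvi : 0 < (w / (l : ℂ) ^ 2).im := by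
      have : w / (l : ℂ) ^ 2 = w / ((l ^ 2 : ℕ) : ℂ) := by push_cast; rfl
      rw [this, Complex.div_natCast_im]; push_cast; positivity
    have := gf_inv hP t hvi
    have e := hrt _ hv0
    rw [show (l : ℂ) ^ 2 * (w / l ^ 2) = w by field_simp] at e
    rw [show (l : ℂ) ^ 2 * (-1 / w) = -1 / (w / l ^ 2) by field_simp, this, J, J, e, div_pow]
    field_simp
    ring
  rw [HS, HS, sum_decomp, sum_decomp, hA, hB, hB2, hC, hD]
  ring

end
end MPC


namespace MPC
open PowerSeries Complex

section
variable (l : ℕ) [hlF : Fact l.Prime]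

/-- twist -/
noncomputable def tw (t : ℕ) (A : ℤ⟦X⟧) : ℤ⟦X⟧ :=
  PowerSeries.mk fun i => quadraticChar (ZMod l) ((24 * i + t : ℕ) : ZMod l) * coeff i A

lemma Conv_tw (t : ℕ) {A : ℤ⟦X⟧} (hA : Conv A) : Conv (tw l t A) := by
  intro x hx hx1
  refine (hA x hx hx1).of_nonneg_of_le (fun n => by positivity) fun n => ?_
  apply mul_le_mul_of_nonneg_right _ (by positivity)
  simp only [tw, coeff_mk]
  push_cast
  rw [abs_mul]
  have : |((quadraticChar (ZMod l) ((24 * n + t : ℕ) : ZMod l) : ℤ) : ℝ)| ≤ 1 := by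
    by_cases h : ((24 * n + t : ℕ) : ZMod l) = 0
    · rw [h]; simp
    · rcases quadraticChar_dichotomy h with h | h <;> rw [h] <;> simp
  push_cast at this
  exact mul_le_of_le_one_left (abs_nonneg _) this

lemma gf_eq {P : ℤ⟦X⟧} (hP : Conv P) (t : ℕ) {z : ℂ} (hz : 0 < z.im) :
    gf P t z = qe (t * z / 24) * ev (Eu ^ t * P) z := by
  rw [gf, ev_mul (Conv_Eu.pow t) hP hz, ev_pow Conv_Eu _ hz, eta, mul_pow, ← qe_nat_mul]
  rw [show (t : ℂ) * (z / 24) = t * z / 24 by ring]; ring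

lemma mid_coeff (h2 : l ≠ 2) (t i : ℕ) (a : ℤ) (z : ℂ) :
    ∑ b : ZMod l, chi l (-b) * (qe (t * (z + 24 * b.val / l) / 24) * ((a : ℂ) * qe (z + 24 * b.val / l) ^ i)) =
      chi l (-1) * (qe (t * z / 24) * (a * qe z ^ i)) *
        (((quadraticChar (ZMod l) ((24 * i + t : ℕ) : ZMod l) : ℤ) : ℂ) * gau l) := by
  have g := gau_shift' l h2 ((24 * i + t : ℕ) : ZMod l)
  rw [← chi_apply, ← g, Finset.mul_sum]
  refine Finset.sum_congr rfl fun b _ => ?_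
  rw [show (-b) = (-1) * b by ring, map_mul]
  have h : (((24 * i + t : ℕ) : ZMod l) * b) = ((((24 * i + t : ℕ) * b.val : ℕ) : ℤ) : ZMod l) := by
    rw [Int.cast_natCast, Nat.cast_mul, ZMod.natCast_val, ZMod.cast_id]
  rw [h, std_qe]
  have q1 : qe (t * (z + 24 * b.val / l) / 24) * qe (z + 24 * b.val / l) ^ i =
      qe (t * z / 24) * qe z ^ i * qe (((((24 * i + t : ℕ) * b.val : ℕ) : ℤ) : ℂ) / l) := by
    rw [← qe_nat_mul, ← qe_nat_mul, ← qe_add, ← qe_add, ← qe_add]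
    congr 1
    push_cast
    ring
  linear_combination (chi l (-1) * chi l b * (a : ℂ)) * q1

lemma mid_sum {P : ℤ⟦X⟧} (hP : Conv P) (h2 : l ≠ 2) (t s : ℕ) (ht : Odd t) {z : ℂ} (hz : 0 < z.im) :
    ∑ u : (ZMod l)ˣ, hm l P t s z (((u : ZMod l).val : ℕ) : ℤ) =
      l ^ s * kap l ^ t * gau l ^ (t + 1) * chi l (-1) * (qe (t * z / 24) * ev (tw l t (Eu ^ t * P)) z) := by
  have hl := hlF.1
  have hl0 : (l : ℂ) ≠ 0 := by exact_mod_cast hl.ne_zero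
  set A := Eu ^ t * P with hA
  have hAc : Conv A := (Conv_Eu.pow t).mul hP
  have hchi : ∀ a : ZMod l, chi l a ^ t = chi l a := by
    intro a
    obtain ⟨k, rfl⟩ := ht
    by_cases ha : a = 0
    · subst ha; simp [chi_apply]
    · rw [pow_succ, pow_mul, chi_sq l ha]; simp
  have e1 : ∑ u : (ZMod l)ˣ, hm l P t s z (((u : ZMod l).val : ℕ) : ℤ) =
      l ^ s * kap l ^ t * gau l ^ t * ∑ b : ZMod l, chi l (-b) * gf P t (z + 24 * b.val / l) := by
    rw [← Finset.sum_subset (Finset.subset_univ (Finset.univ.image (fun u : (ZMod l)ˣ => (u : ZMod l)))),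
      Finset.sum_image (fun a _ b _ h => Units.ext h), Finset.mul_sum]
    · refine Finset.sum_congr rfl fun u _ => ?_
      rw [hm, mul_pow, mul_pow, hchi]
      push_cast
      rw [ZMod.natCast_val, ZMod.cast_id]
      ring
    · intro b _ hb
      have : b = 0 := by
        by_contra h
        exact hb (Finset.mem_image.2 ⟨Units.mk0 b h, Finset.mem_univ _, rfl⟩)
      subst this
      simp [chi_apply]
  have e2 : ∑ b : ZMod l, chi l (-b) * gf P t (z + 24 * b.val / l) =
      chi l (-1) * gau l * (qe (t * z / 24) * ev (tw l t A) z) := by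
    have him : ∀ b : ZMod l, 0 < (z + 24 * b.val / l : ℂ).im := by
      intro b
      have : (z + 24 * b.val / l : ℂ) = z + ((24 * b.val / l : ℝ) : ℂ) := by push_cast; rfl
      rw [this]; simpa using hz
    have s1 : HasSum (fun i => ∑ b : ZMod l, chi l (-b) * (qe (t * (z + 24 * b.val / l) / 24) *
        (((coeff i A : ℤ) : ℂ) * qe (z + 24 * b.val / l) ^ i)))
        (∑ b : ZMod l, chi l (-b) * gf P t (z + 24 * b.val / l)) :=
      hasSum_sum fun b _ => by
        rw [gf_eq hP t (him b)]
        exact ((hAc.hasSum (him b)).mul_left _).mul_left _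
    have s2 := (((Conv_tw l t hAc).hasSum hz).mul_left (qe (t * z / 24))).mul_left (chi l (-1) * gau l)
    refine s1.unique (s2.congr_fun fun i => ?_)
    have := mid_coeff l h2 t i (coeff i A) z
    simp only [tw, coeff_mk]
    rw [this]; push_cast; ring
  rw [e1, e2]; ring

/-- Hecke operator of half-integral weight on coefficients -/
noncomputable def TT {R : Type*} [CommRing R] (t δ : ℕ) (Cc c : ℤ) (A : R⟦X⟧) : R⟦X⟧ :=
  PowerSeries.mk fun i => coeff (l ^ 2 * i + δ) A + Cc * (quadraticChar (ZMod l) ((24 * i + t : ℕ) : ZMod l) : ℤ) * coeff i A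
    + c * coeff i (X ^ δ * expand (l ^ 2) (pow_ne_zero 2 hlF.1.ne_zero) A)

lemma TT_eq (t δ : ℕ) (Cc c : ℤ) (A : ℤ⟦X⟧) : TT l t δ Cc c A = MPC.sub (l ^ 2) δ A + C Cc * tw l t A +
    C c * (X ^ δ * expand (l ^ 2) (pow_ne_zero 2 hlF.1.ne_zero) A) := by
  ext i
  simp only [TT, coeff_mk, map_add, coeff_C_mul, MPC.sub, tw]
  push_cast; ring

lemma HS_eq {P : ℤ⟦X⟧} (hP : Conv P) (h2 : l ≠ 2) (h3 : l ≠ 3) (t s δ : ℕ) (ht : Odd t) (ht24 : t < 24)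
    (hδ : 24 * δ + t = t * l ^ 2) (ε : ℤ) (hε : kap l = ε) (hε2 : ε ^ 2 = 1) (hs : 2 ≤ s) {z : ℂ} (hz : 0 < z.im) :
    HS l P t s z = l ^ 2 * (qe (t * z / 24) * ev (TT l t δ
      (ε * quadraticChar (ZMod l) (-1) ^ ((t + 1) / 2 + 1) * l ^ (s - 2 + (t + 1) / 2)) (l ^ (2 * s + t - 2)) (Eu ^ t * P)) z) := by
  have hl := hlF.1
  have hl0 : (l : ℂ) ≠ 0 := by exact_mod_cast hl.ne_zero
  have hlp : (0 : ℝ) < l := by exact_mod_cast hl.pos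
  have hL : 0 < l ^ 2 := pow_pos hl.pos 2
  set A := Eu ^ t * P with hA
  have hAc : Conv A := (Conv_Eu.pow t).mul hP
  have hδ' : (24 * δ + t : ℂ) = t * l ^ 2 := by exact_mod_cast hδ
  have hδl : δ < l ^ 2 := by nlinarith
  have c24 : IsCoprime ((l ^ 2 : ℕ) : ℤ) 24 := by
    have : Nat.Coprime (l ^ 2) 24 := by
      refine Nat.Coprime.pow_left _ ?_
      have := coprime576 l h2 h3
      exact (Nat.Coprime.coprime_dvd_left (by norm_num : 24 ∣ 576) this).symm
    exact Nat.isCoprime_iff_coprime.2 this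
  rw [HS, mid_sum l hP h2 t s ht hz, TT_eq]
  rw [ev_add ((hAc.sub _ _ hL).add ((Conv_tw l t hAc).const_mul _)) (((Conv.X.pow δ).mul (hAc.expand _ _)).const_mul _) hz,
    ev_add (hAc.sub _ _ hL) ((Conv_tw l t hAc).const_mul _) hz, ev_C_mul, ev_C_mul,
    ev_mul (Conv.X.pow δ) (hAc.expand _ _) hz, ev_pow Conv.X _ hz, ev_X, ev_expand]
  have s1 : ∑ b ∈ Finset.range (l ^ 2), gf P t ((z + 24 * b) / (l ^ 2 : ℕ)) =
      l ^ 2 * (qe (t * z / 24) * ev (MPC.sub (l ^ 2) δ A) z) := by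
    have := avg hAc (l ^ 2) hL 24 c24 δ hδl hz
    push_cast at this ⊢
    rw [mul_left_comm, ← this, Finset.mul_sum]
    refine Finset.sum_congr rfl fun b _ => ?_
    have him : 0 < ((z + 24 * b) / (l : ℂ) ^ 2).im := by
      have e : (z + 24 * b) / (l : ℂ) ^ 2 = (z + 24 * b) / ((l ^ 2 : ℕ) : ℂ) := by push_cast; rfl
      rw [e, Complex.div_natCast_im]
      apply div_pos _ (by positivity)
      simpa using hz
    rw [gf_eq hP t him, ← mul_assoc, ← qe_add]
    congr 1
    apply qe_eq_of_sub _ _ (t * b : ℤ)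
    push_cast
    field_simp
    linear_combination (z + 24 * b) * hδ'
  have s3 : gf P t (l ^ 2 * z) = qe (t * z / 24) * (qe z ^ δ * ev A (l ^ 2 * z)) := by
    have him : 0 < ((l : ℂ) ^ 2 * z).im := by
      have : (l : ℂ) ^ 2 * z = ((l ^ 2 : ℝ) : ℂ) * z := by push_cast; rfl
      rw [this, Complex.im_ofReal_mul]; positivity
    rw [gf_eq hP t him, ← qe_nat_mul, ← mul_assoc (qe (t * z / 24)), ← qe_add, ← hA]
    congr 2
    linear_combination -z / 24 * hδ'
  rw [s1, s3]
  obtain ⟨t', rfl⟩ := ht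
  obtain ⟨s', rfl⟩ : ∃ s', s = s' + 2 := ⟨s - 2, by omega⟩
  have c1 : (kap l : ℂ) ^ (2 * t' + 1) = ε := by
    rw [hε, pow_succ, pow_mul]
    have : (ε : ℂ) ^ 2 = 1 := by exact_mod_cast hε2
    rw [this]; simp
  have c2 : gau l ^ (2 * t' + 1 + 1) = (chi l (-1) * l) ^ (t' + 1) := by
    rw [← gau_sq l h2, ← pow_mul]; congr 1
  rw [c1, c2, show (2 * t' + 1 + 1) / 2 = t' + 1 by omega, show s' + 2 - 2 = s' by omega,
    show 2 * (s' + 2) + (2 * t' + 1) - 2 = 2 * s' + 2 * t' + 3 by omega, chi_apply]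
  push_cast
  ring

/-- the Hecke operator preserves the module -/
lemma TT_stable (h2 : l ≠ 2) (h3 : l ≠ 3) (t s : ℕ) (ht : Odd t) (ht24 : t < 24) (hs : 2 ≤ s) (hse : Even s) :
    ∃ (Cc : ℤ) (e δ : ℕ), 24 * δ + t = t * l ^ 2 ∧ ∀ P, MF s P → ∃ P', MF s P' ∧ Eu ^ t * P' = TT l t δ Cc (l ^ e) (Eu ^ t * P) := by
  have hl := hlF.1
  have hl0 : (l : ℂ) ≠ 0 := by exact_mod_cast hl.ne_zero
  have m2 : l % 2 = 1 := hl.mod_two_eq_one_iff_ne_two.2 h2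
  have m3 : l % 3 ≠ 0 := by
    intro h
    have := (Nat.prime_dvd_prime_iff_eq Nat.prime_three hl).1 (Nat.dvd_of_mod_eq_zero h)
    exact h3 this.symm
  obtain ⟨ε, hε, hε2⟩ : ∃ ε : ℤ, kap l = ε ∧ ε ^ 2 = 1 := by
    have hk := kap_sq l m2 m3
    have hk' : (kap l - 1) * (kap l + 1) = 0 := by linear_combination hk
    rcases mul_eq_zero.1 hk' with h | h
    · exact ⟨1, by push_cast; linear_combination h, by norm_num⟩
    · exact ⟨-1, by push_cast; linear_combination h, by norm_num⟩
  obtain ⟨δ, hδ⟩ : ∃ δ, 24 * δ + t = t * l ^ 2 := by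
    have : l ^ 2 % 24 = 1 := by
      have h1 : l % 24 < 24 := Nat.mod_lt _ (by norm_num)
      rw [Nat.pow_mod]
      have a2 : (l % 24) % 2 = 1 := by omega
      have a3 : (l % 24) % 3 ≠ 0 := by omega
      generalize l % 24 = a at *
      interval_cases a <;> simp_all
    refine ⟨t * (l ^ 2 / 24), ?_⟩
    have e : l ^ 2 = 24 * (l ^ 2 / 24) + 1 := by omega
    conv_rhs => rw [e]
    ring
  refine ⟨ε * quadraticChar (ZMod l) (-1) ^ ((t + 1) / 2 + 1) * l ^ (s - 2 + (t + 1) / 2), 2 * s + t - 2, δ, hδ, fun P hP => ?_⟩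
  set B := TT l t δ (ε * quadraticChar (ZMod l) (-1) ^ ((t + 1) / 2 + 1) * l ^ (s - 2 + (t + 1) / 2)) (l ^ (2 * s + t - 2)) (Eu ^ t * P) with hB
  have hBc : Conv B := by
    have hAc : Conv (Eu ^ t * P) := (Conv_Eu.pow t).mul hP.1
    rw [hB, TT_eq]
    exact ((hAc.sub _ _ (pow_pos hl.pos 2)).add ((Conv_tw l t hAc).const_mul _)).add (((Conv.X.pow δ).mul (hAc.expand _ _)).const_mul _)
  have hE : Eu ^ t * (Pg ^ t * B) = B := by rw [← mul_assoc, Eu_pow_mul_Pg_pow, one_mul]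
  refine ⟨Pg ^ t * B, ⟨(Conv_Pg.pow t).mul hBc, fun z hz => ?_⟩, hE⟩
  have key : ∀ w : ℂ, 0 < w.im → HS l P t s w = l ^ 2 * (eta w ^ t * ev (Pg ^ t * B) w) := by
    intro w hw
    rw [HS_eq l hP.1 h2 h3 t s δ ht ht24 hδ ε hε hε2 hs hw, ← hB]
    have := gf_eq ((Conv_Pg.pow t).mul hBc) t hw
    rw [hE] at this
    rw [← this, gf]
  have h1 := HS_inv l hse hP h2 h3 t hz
  rw [key _ hz, key _ (im_neg_inv hz), key1 hz, J] at h1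
  have hz0 : z ≠ 0 := by rintro rfl; simp at hz
  have hne : (l : ℂ) ^ 2 * (rt z ^ t * eta z ^ t) ≠ 0 :=
    mul_ne_zero (pow_ne_zero _ hl0) (mul_ne_zero (pow_ne_zero _ (rt_ne_zero hz0)) (pow_ne_zero _ (eta_ne_zero' hz)))
  apply mul_left_cancel₀ hne
  linear_combination h1

end
end MPC


namespace MPC
open PowerSeries Complex

lemma iter_aux {R V : Type*} [CommRing R] (Φ : V × V → V × V) (T : V → V) (c : R) (F z : V) (e : ℕ → V → R)
    (h2 : ∀ p, (Φ p).2 = p.1) (h1 : ∀ i p, e i (Φ p).1 = e i (T p.1) - c * e i p.2)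
    (hz : ∀ i, e i z = 0) (e0 : ∀ a, e 0 (T a) = e 1 a) (e1 : ∀ i a, e (i + 1) (T a) = e (i + 2) a + c * e i a) (j : ℕ) :
    e 0 (Φ^[j] (F, z)).1 = e j F ∧ ∀ i, e (i + 1) (Φ^[j] (F, z)).1 - c * e i (Φ^[j] (F, z)).2 = e (i + j + 1) F := by
  induction j with
  | zero => simp [hz]
  | succ j ih =>
    rw [Function.iterate_succ_apply']
    refine ⟨?_, fun i => ?_⟩
    · rw [h1, e0]; simpa using ih.2 0
    · rw [h1, h2, e1, show i + (j + 1) + 1 = (i + 1) + j + 1 by ring, ← ih.2 (i + 1)]; ring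

lemma period_aux {V : Type*} (S : Set V) (hS : S.Finite) (Φ : V → V) (hinj : Function.Injective Φ)
    (hm : ∀ a ∈ S, Φ a ∈ S) (x : V) (hx : x ∈ S) : ∃ K, 0 < K ∧ ∀ μ, Φ^[μ * K] x = x := by
  have : Finite S := hS
  have hr : Set.MapsTo Φ S S := hm
  have hi : Function.Injective hr.restrict := fun a b h => Subtype.ext (hinj (congrArg Subtype.val h))
  obtain ⟨K, hK, hp⟩ := hi.mem_periodicPts ⟨x, hx⟩
  refine ⟨K, hK, fun μ => ?_⟩
  have h2 : Function.IsPeriodicPt Φ K x := by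
    have := congrArg Subtype.val hp
    rw [Set.MapsTo.iterate_restrict] at this
    exact this
  exact h2.const_mul μ

section
variable (l : ℕ) [hlF : Fact l.Prime]

lemma red_TT (q t δ : ℕ) (Cc c : ℤ) (A : ℤ⟦X⟧) : red q (TT l t δ Cc c A) = TT l t δ Cc c (red q A) := by
  ext i
  have : X ^ δ * expand (l ^ 2) (pow_ne_zero 2 hlF.1.ne_zero) (red q A) =
      red q (X ^ δ * expand (l ^ 2) (pow_ne_zero 2 hlF.1.ne_zero) A) := by
    rw [map_mul, map_pow, map_X, red, map_expand]
  simp only [TT, coeff_map, coeff_mk]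
  rw [this]
  simp only [coeff_map, eq_intCast]
  push_cast
  rfl

lemma TT_add {R : Type*} [CommRing R] (t δ : ℕ) (Cc c : ℤ) (I n : ℕ) (hI : 24 * I + t = l * n)
    (hδ : 24 * δ + t = t * l ^ 2) (hn : ¬ l ∣ n) (a : R⟦X⟧) :
    coeff I (TT l t δ Cc c a) = coeff (l ^ 2 * I + δ) a := by
  simp only [TT, coeff_mk]
  rw [hI, coeff_X_pow_mul', coeff_expand]
  have : ¬ (δ ≤ I ∧ l ^ 2 ∣ I - δ) := by
    rintro ⟨h1, j, hj⟩
    have e : I = l ^ 2 * j + δ := by omega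
    rw [e] at hI
    apply hn
    refine ⟨24 * j + t, ?_⟩
    have : l * n = l * (l * (24 * j + t)) := by
      rw [← hI]; linear_combination hδ
    exact Nat.eq_of_mul_eq_mul_left hlF.1.pos this
  by_cases h1 : δ ≤ I
  · have h2 : ¬ l ^ 2 ∣ I - δ := fun h => this ⟨h1, h⟩
    simp [h1, h2]
  · simp [h1]

lemma TT_add' {R : Type*} [CommRing R] (t δ : ℕ) (Cc c : ℤ) (I : ℕ) (hI : l ∣ 24 * I + t)
    (hδ : 24 * δ + t = t * l ^ 2) (a : R⟦X⟧) :
    coeff (l ^ 2 * I + δ) (TT l t δ Cc c a) = coeff (l ^ 2 * (l ^ 2 * I + δ) + δ) a + c * coeff I a := by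
  simp only [TT, coeff_mk]
  have h : ((24 * (l ^ 2 * I + δ) + t : ℕ) : ZMod l) = 0 := by
    rw [ZMod.natCast_eq_zero_iff]
    have : 24 * (l ^ 2 * I + δ) + t = l ^ 2 * (24 * I + t) := by linear_combination hδ
    rw [this]; exact hI.mul_left _
  rw [h, coeff_X_pow_mul', coeff_expand]
  simp [Nat.pos_of_ne_zero hlF.1.ne_zero, hlF.1.ne_zero]

end

theorem final (m k r ℓ : ℕ) (hm : m.Prime) (hm5 : 5 ≤ m) (hk : 0 < k)
    (hr : 0 < r) (hrodd : Odd r) (hrm : r < m ^ k) (hl : ℓ.Prime) (hl2 : ℓ ≠ 2) (hl3 : ℓ ≠ 3) (hlm : ℓ ≠ m) :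
    ∃ K : ℕ, 0 < K ∧ ∀ μ n : ℕ, 0 < μ → 0 < n → n.Coprime ℓ → 24 ∣ m ^ k * ℓ ^ (2 * μ * K - 1) * n + r →
    m ^ k ∣ multipartition r ((m ^ k * ℓ ^ (2 * μ * K - 1) * n + r) / 24) := by
  haveI : Fact ℓ.Prime := ⟨hl⟩
  haveI : NeZero (m ^ k) := ⟨(pow_pos hm.pos k).ne'⟩
  obtain ⟨t, τ, P, htodd, ht24, hτ, hP, hcoef, hex⟩ := exists_form m k r hm hm5 hk hr hrodd hrm
  obtain ⟨Cc, e, δ, hδ, hst⟩ := TT_stable ℓ hl2 hl3 t (12 * τ) htodd ht24 (by omega) ⟨6 * τ, by ring⟩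
  set q := m ^ k with hq
  let R := ZMod q
  let S : Set R⟦X⟧ := {f | ∃ P, MF (12 * τ) P ∧ f = red q (Eu ^ t * P)}
  have hS : S.Finite := by
    refine ((MF_finite q τ).image (fun f => red q (Eu ^ t) * f)).subset ?_
    rintro f ⟨Q, hQ, rfl⟩
    exact ⟨red q Q, ⟨Q, hQ, rfl⟩, by simp only [map_mul]⟩
  let c : R := ((ℓ ^ e : ℤ) : R)
  have hc : IsUnit c := by
    have : c = ((ℓ ^ e : ℕ) : ZMod q) := by simp [c, R]
    rw [this, ZMod.isUnit_iff_coprime]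
    exact Nat.Coprime.pow _ _ ((Nat.coprime_primes hl hm).2 hlm)
  let T : R⟦X⟧ → R⟦X⟧ := TT ℓ t δ Cc (ℓ ^ e)
  let Φ : R⟦X⟧ × R⟦X⟧ → R⟦X⟧ × R⟦X⟧ := fun p => (T p.1 - C c * p.2, p.1)
  have hinj : Function.Injective Φ := by
    rintro ⟨a, b⟩ ⟨a', b'⟩ h
    simp only [Φ, Prod.mk.injEq] at h
    obtain ⟨h, rfl⟩ := h
    have h' := sub_right_injective h
    have := (hc.map (C (R := R))).mul_left_cancel h'
    rw [this]
  have hmap : ∀ a ∈ S ×ˢ S, Φ a ∈ S ×ˢ S := by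
    rintro ⟨_, _⟩ ⟨⟨Q, hQ, rfl⟩, ⟨Q', hQ', rfl⟩⟩
    refine ⟨?_, ⟨Q, hQ, rfl⟩⟩
    obtain ⟨Q1, hQ1, e1⟩ := hst Q hQ
    refine ⟨Q1 - C (ℓ ^ e : ℤ) * Q', hQ1.sub (hQ'.const_mul _), ?_⟩
    simp only [Φ, T]
    rw [← red_TT, ← e1, mul_sub, map_sub, mul_left_comm, map_mul _ (C _), red, map_C]
    rfl
  have hF : (red q (Eu ^ t * P), (0 : R⟦X⟧)) ∈ S ×ˢ S := by
    refine ⟨⟨P, hP, rfl⟩, ⟨0, ?_, by simp⟩⟩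
    simpa using hP.sub hP
  obtain ⟨K, hK, hper⟩ := period_aux _ (hS.prod hS) Φ hinj hmap _ hF
  refine ⟨K, hK, fun μ n hμ hn hcop hdvd => ?_⟩
  obtain ⟨j, hj⟩ : ∃ j, μ * K = j + 1 := ⟨μ * K - 1, by have := Nat.mul_pos hμ hK; omega⟩
  have hexp : 2 * μ * K - 1 = 2 * j + 1 := by rw [mul_assoc, hj]; omega
  rw [hexp] at hdvd ⊢
  rw [mul_assoc] at hdvd ⊢
  obtain ⟨i, hi⟩ := hex _ (Nat.mul_pos (pow_pos hl.pos _) hn) hdvd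
  have hln : ¬ ℓ ∣ n := fun h => hl.one_lt.ne' (Nat.dvd_one.1 (hcop ▸ Nat.dvd_gcd h dvd_rfl))
  have hl24 : ℓ ^ 2 % 24 = 1 := by
    have m2 : ℓ % 2 = 1 := hl.mod_two_eq_one_iff_ne_two.2 hl2
    have m3 : ℓ % 3 ≠ 0 := by
      intro h
      have := (Nat.prime_dvd_prime_iff_eq Nat.prime_three hl).1 (Nat.dvd_of_mod_eq_zero h)
      exact hl3 this.symm
    have h1 : ℓ % 24 < 24 := Nat.mod_lt _ (by norm_num)
    rw [Nat.pow_mod]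
    have a2 : (ℓ % 24) % 2 = 1 := by omega
    have a3 : (ℓ % 24) % 3 ≠ 0 := by omega
    generalize ℓ % 24 = a at *
    interval_cases a <;> simp_all
  obtain ⟨I0, hI0⟩ : ∃ I0, 24 * I0 + t = ℓ * n := by
    have h1 : (ℓ ^ (2 * j + 1) * n) ≡ ℓ * n [MOD 24] := by
      have : ℓ ^ 2 ≡ 1 [MOD 24] := hl24
      have := ((this.pow j).mul_right (ℓ * n))
      rw [one_pow, one_mul] at this
      convert this using 1
      ring
    rw [hi] at h1
    have h2 : (24 * i + t) % 24 = (ℓ * n) % 24 := h1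
    exact ⟨ℓ * n / 24, by omega⟩
  let I : ℕ → ℕ := fun i => (fun x => ℓ ^ 2 * x + δ)^[i] I0
  have hIs : ∀ i, I (i + 1) = ℓ ^ 2 * I i + δ := fun i => Function.iterate_succ_apply' _ _ _
  have hIv : ∀ i, 24 * I i + t = ℓ ^ (2 * i + 1) * n := by
    intro i
    induction i with
    | zero => simpa [I] using hI0
    | succ i ih =>
      rw [hIs]
      have : 24 * (ℓ ^ 2 * I i + δ) + t = ℓ ^ 2 * (24 * I i + t) := by linear_combination hδ
      rw [this, ih]; ring
  have hij : i = I j := by have := hIv j; omega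
  have key := iter_aux Φ T c (red q (Eu ^ t * P)) 0 (fun i a => coeff (I i) a) (fun p => rfl)
    (fun i p => by simp only [Φ, map_sub, coeff_C_mul]) (fun i => map_zero _)
    (fun a => TT_add ℓ t δ Cc _ I0 n hI0 hδ hln a |>.trans (by rw [hIs]; rfl))
    (fun i a => by
      simp only [T, hIs]
      exact TT_add' ℓ t δ Cc _ (I i) (by rw [hIv, pow_succ, mul_assoc]; exact (dvd_mul_right _ _).mul_left _) hδ a) j
  have h0 := hper μ
  rw [hj, Function.iterate_succ_apply'] at h0
  have h0' : (Φ^[j] (red q (Eu ^ t * P), 0)).1 = 0 := congrArg Prod.snd h0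
  have k1 := key.1
  rw [h0', map_zero, ← hij] at k1
  have := hcoef i
  rw [← k1, ← hi] at this
  exact (ZMod.natCast_eq_zero_iff _ _).1 this

end MPC

theorem multipartition_prime_power_congruence
    (m k r ℓ : ℕ) (hm : m.Prime) (hm5 : 5 ≤ m) (hk : 0 < k)
    (hr : 0 < r) (hrodd : Odd r) (hrm : r < m ^ k)
    (hl : ℓ.Prime) (hl2 : ℓ ≠ 2) (hl3 : ℓ ≠ 3) (hlm : ℓ ≠ m) :
    ∃ K : ℕ, 0 < K ∧ ∀ μ n : ℕ, 0 < μ → 0 < n → n.Coprime ℓ →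
      24 ∣ m ^ k * ℓ ^ (2 * μ * K - 1) * n + r →
      m ^ k ∣ multipartition r ((m ^ k * ℓ ^ (2 * μ * K - 1) * n + r) / 24) := by
  exact MPC.final m k r ℓ hm hm5 hk hr hrodd hrm hl hl2 hl3 hlm
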